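/- arXiv:2409.16240 — 3 statements merged into one kernel-verified Lean document; each statement's English description precedes it below -/
import Mathlib

section
/- Let X be a nonempty set, Θ a nondegenerate open interval of ℝ, and M : ⋃_{n≥1} Xⁿ → Θ a function (with M_n its restriction to Xⁿ) such that inf M₁(X) = inf Θ and sup M₁(X) = sup Θ. Then the following are equivalent: (i) there exists a function ψ ∈ Ψ(X,Θ) possessing property [T] such that ϑ_{n,ψ}(x₁,…,xₙ) = M_n(x₁,…,xₙ) for all n ∈ ℕ and x₁,…,xₙ ∈ X; (ii) M is symmetric (M_n(x₁,…,xₙ) = M_n(x_{π(1)},…,x_{π(n)}) for every permutation π), internal (min(M_n(x₁,…,xₙ), M_k(y₁,…,y_k)) ≤ M_{n+k}(x₁,…,xₙ,y₁,…,y_k) ≤ max(M_n(x₁,…,xₙ), M_k(y₁,…,y_k)) for all n,k and all arguments), and asymptotically idempotent (for all k ∈ ℕ and x₁,…,x_k, y ∈ X, M_{kn+1}(x₁,…,x₁,…,x_k,…,x_k,y), with each xᵢ repeated n times, converges to M_k(x₁,…,x_k) as n → ∞). -/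
open Filter Topology

/-- `ψ ∈ Ψ(X,Θ)`: for every `x ∈ X` there exist `t₊ < t₋` in `Θ` with
`ψ x t₊ > 0 > ψ x t₋`. -/
def PsiClass {X : Type*} (Θ : Set ℝ) (ψ : X → ℝ → ℝ) : Prop :=
  ∀ x : X, ∃ tp ∈ Θ, ∃ tm ∈ Θ, tp < tm ∧ 0 < ψ x tp ∧ ψ x tm < 0

/-- `ϑ` is a generalized `ψ`-estimator on `n`-tuples: for every tuple `x`,
`ϑ x ∈ Θ` and `ϑ x` is a point of sign change (of decreasing type) of the map
`t ↦ ∑ i, ψ (x i) t` on `Θ`. -/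
def IsThetaEst {X : Type*} (Θ : Set ℝ) (ψ : X → ℝ → ℝ) (n : ℕ)
    (ϑ : (Fin n → X) → ℝ) : Prop :=
  ∀ x : Fin n → X, ϑ x ∈ Θ ∧
    (∀ t ∈ Θ, t < ϑ x → 0 < ∑ i, ψ (x i) t) ∧
    (∀ t ∈ Θ, ϑ x < t → ∑ i, ψ (x i) t < 0)

/-- The `k*n`-tuple in which each entry `x i` of the `k`-tuple `x` is repeated
`n` times. -/
def repBlock {X : Type*} {k : ℕ} (n : ℕ) (x : Fin k → X) (i : Fin (k * n)) : X :=
  x ⟨i.val / n, by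
    have h := i.isLt
    rcases Nat.eq_zero_or_pos n with hn | hn
    · subst hn; simp at h
    · exact (Nat.div_lt_iff_lt_mul hn).mpr h⟩

section RieszExtensionRat

variable {E : Type*} [AddCommGroup E] [Module ℚ E]

/-- One-step extension in the Riesz extension theorem for `ℚ`-linear real functionals. -/
theorem ratRieszExtension_step (s : ConvexCone ℚ E) (f : E →ₗ.[ℚ] ℝ)
    (nonneg : ∀ x : f.domain, (x : E) ∈ s → 0 ≤ f x)
    (dense : ∀ y, ∃ x : f.domain, (x : E) + y ∈ s) (hdom : f.domain ≠ ⊤) :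
    ∃ g, f < g ∧ ∀ x : g.domain, (x : E) ∈ s → 0 ≤ g x := by
  obtain ⟨y, -, hy⟩ : ∃ y ∈ ⊤, y ∉ f.domain := SetLike.exists_of_lt (lt_top_iff_ne_top.2 hdom)
  obtain ⟨c, le_c, c_le⟩ :
      ∃ c, (∀ x : f.domain, -(x : E) - y ∈ s → f x ≤ c) ∧
        ∀ x : f.domain, (x : E) + y ∈ s → c ≤ f x := by
    set Sp := f '' { x : f.domain | (x : E) + y ∈ s }
    set Sn := f '' { x : f.domain | -(x : E) - y ∈ s }
    suffices (upperBounds Sn ∩ lowerBounds Sp).Nonempty by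
      simpa only [Sp, Sn, Set.Nonempty, upperBounds, lowerBounds, Set.forall_mem_image] using! this
    refine exists_between_of_forall_le (Set.Nonempty.image f ?_)
      (Set.Nonempty.image f (dense y)) ?_
    · rcases dense (-y) with ⟨x, hx⟩
      rw [← neg_neg x, NegMemClass.coe_neg, ← sub_eq_add_neg] at hx
      exact ⟨_, hx⟩
    rintro a ⟨xn, hxn, rfl⟩ b ⟨xp, hxp, rfl⟩
    have := s.add_mem hxp hxn
    rw [add_assoc, add_sub_cancel, ← sub_eq_add_neg, ← AddSubgroupClass.coe_sub] at this
    replace := nonneg _ this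
    rwa [f.map_sub, sub_nonneg] at this
  refine ⟨f.supSpanSingleton y (-c) hy, ?_, ?_⟩
  · refine lt_iff_le_not_ge.2 ⟨f.left_le_sup _ _, fun H => ?_⟩
    replace H := LinearPMap.domain_mono.monotone H
    rw [LinearPMap.domain_supSpanSingleton, sup_le_iff, Submodule.span_le,
      Set.singleton_subset_iff] at H
    exact hy H.2
  · rintro ⟨z, hz⟩ hzs
    rcases Submodule.mem_sup.1 hz with ⟨x, hx, y', hy', rfl⟩
    rcases Submodule.mem_span_singleton.1 hy' with ⟨r, rfl⟩
    simp only at hzs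
    rw [LinearPMap.supSpanSingleton_apply_mk _ _ _ _ _ hx, smul_neg, ← sub_eq_add_neg, sub_nonneg,
      RingHom.id_apply, Rat.smul_def]
    rcases lt_trichotomy r 0 with (hr | hr | hr)
    · have hmem : -(r⁻¹ • x) - y ∈ s := by
        rwa [← s.smul_mem_iff (neg_pos.2 hr), smul_sub, smul_neg, neg_smul, neg_neg, smul_smul,
          mul_inv_cancel₀ hr.ne, one_smul, sub_eq_add_neg, neg_smul, neg_neg]
      have hle := le_c (r⁻¹ • ⟨x, hx⟩) hmem
      have hr' : (r : ℝ) < 0 := by exact_mod_cast hr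
      rw [f.map_smul, Rat.smul_def, Rat.cast_inv] at hle
      have := mul_le_mul_of_nonpos_left hle hr'.le
      rwa [← mul_assoc, mul_inv_cancel₀ hr'.ne, one_mul] at this
    · subst r
      simp only [zero_smul, add_zero] at hzs
      rw [Rat.cast_zero, zero_mul]
      exact nonneg _ hzs
    · have hmem : r⁻¹ • x + y ∈ s := by
        rwa [← s.smul_mem_iff hr, smul_add, smul_smul, mul_inv_cancel₀ hr.ne', one_smul]
      have hle := c_le (r⁻¹ • ⟨x, hx⟩) hmem
      have hr' : 0 < (r : ℝ) := by exact_mod_cast hr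
      rw [f.map_smul, Rat.smul_def, Rat.cast_inv] at hle
      have := mul_le_mul_of_nonneg_left hle hr'.le
      rwa [← mul_assoc, mul_inv_cancel₀ hr'.ne', one_mul] at this

/-- A nonnegative `ℚ`-linear functional on a subspace extends to one with full domain. -/
theorem ratRieszExtension_exists_top (s : ConvexCone ℚ E) (p : E →ₗ.[ℚ] ℝ)
    (hp_nonneg : ∀ x : p.domain, (x : E) ∈ s → 0 ≤ p x)
    (hp_dense : ∀ y, ∃ x : p.domain, (x : E) + y ∈ s) :
    ∃ q ≥ p, q.domain = ⊤ ∧ ∀ x : q.domain, (x : E) ∈ s → 0 ≤ q x := by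
  set S := { p : E →ₗ.[ℚ] ℝ | ∀ x : p.domain, (x : E) ∈ s → 0 ≤ p x }
  have hSc : ∀ c, c ⊆ S → IsChain (· ≤ ·) c → ∀ y ∈ c, ∃ ub ∈ S, ∀ z ∈ c, z ≤ ub := by
    intro c hcs c_chain y hy
    have cne : c.Nonempty := ⟨y, hy⟩
    have hcd : DirectedOn (· ≤ ·) c := c_chain.directedOn
    refine ⟨LinearPMap.sSup c hcd, ?_, fun _ ↦ LinearPMap.le_sSup hcd⟩
    rintro ⟨x, hx⟩ hxs
    have hdir : DirectedOn (· ≤ ·) (LinearPMap.domain '' c) :=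
      directedOn_image.2 (hcd.mono LinearPMap.domain_mono.monotone)
    rcases (Submodule.mem_sSup_of_directed (cne.image _) hdir).1 hx with
      ⟨_, ⟨f, hfc, rfl⟩, hfx⟩
    have : f ≤ LinearPMap.sSup c hcd := LinearPMap.le_sSup _ hfc
    convert! ← hcs hfc ⟨x, hfx⟩ hxs using 1
    exact this.2 rfl
  obtain ⟨q, hpq, hqs, hq⟩ := zorn_le_nonempty₀ S hSc p hp_nonneg
  refine ⟨q, hpq, ?_, hqs⟩
  contrapose! hq
  have hqd : ∀ y, ∃ x : q.domain, (x : E) + y ∈ s := fun y ↦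
    let ⟨x, hx⟩ := hp_dense y
    ⟨Submodule.inclusion hpq.left x, hx⟩
  rcases ratRieszExtension_step s q hqs hqd hq with ⟨r, hqr, hr⟩
  exact ⟨r, hr, hqr.le, fun hrq ↦ hqr.ne' <| hrq.antisymm hqr.le⟩

/-- **Riesz extension theorem** for real-valued functionals on a rational vector space. -/
theorem rat_riesz_extension (s : ConvexCone ℚ E) (f : E →ₗ.[ℚ] ℝ)
    (nonneg : ∀ x : f.domain, (x : E) ∈ s → 0 ≤ f x)
    (dense : ∀ y, ∃ x : f.domain, (x : E) + y ∈ s) :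
    ∃ g : E →ₗ[ℚ] ℝ, (∀ x : f.domain, g x = f x) ∧ ∀ x ∈ s, 0 ≤ g x := by
  rcases ratRieszExtension_exists_top s f nonneg dense
    with ⟨⟨g_dom, g⟩, ⟨-, hfg⟩, rfl : g_dom = ⊤, hgs⟩
  refine ⟨g.comp (LinearMap.id.codRestrict ⊤ fun _ ↦ trivial), ?_, ?_⟩
  · exact fun x => (hfg rfl).symm
  · exact fun x hx => hgs ⟨x, _⟩ hx

/-- A nonempty algebraically open convex cone not containing the origin is contained in an open
half-space. -/
theorem ConvexCone.exists_pos_of_open (s : ConvexCone ℚ E) {e : E} (he : e ∈ s)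
    (h0 : (0 : E) ∉ s) (hopen : ∀ v ∈ s, ∀ y, ∃ r : ℚ, 0 < r ∧ r • v + y ∈ s) :
    ∃ g : E →ₗ[ℚ] ℝ, ∀ x ∈ s, 0 < g x := by
  have he0 : e ≠ 0 := fun h => h0 (h ▸ he)
  obtain ⟨g, hgf, hgs⟩ := rat_riesz_extension s (LinearPMap.mkSpanSingleton e (1 : ℝ) he0)
    (by
      rintro ⟨x, hx⟩ hxs
      obtain ⟨r, rfl⟩ := Submodule.mem_span_singleton.1 hx
      have hval : LinearPMap.mkSpanSingleton e (1 : ℝ) he0 ⟨r • e, hx⟩ = r • (1 : ℝ) :=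
        LinearPMap.mkSpanSingleton'_apply ..
      rw [hval, Rat.smul_def, mul_one]
      by_contra! hr
      have hr' : 0 < -r := by
        have : r < 0 := by exact_mod_cast hr
        linarith
      refine h0 ?_
      have := s.add_mem (s.smul_mem hr' he) hxs
      simpa using this)
    (fun y => by
      obtain ⟨r, -, hr⟩ := hopen e he y
      exact ⟨⟨r • e, Submodule.mem_span_singleton.2 ⟨r, rfl⟩⟩, hr⟩)
  have hge : g e = 1 := by
    have := hgf ⟨e, Submodule.mem_span_singleton_self e⟩
    rw [this]
    exact LinearPMap.mkSpanSingleton_apply ℚ ℚ he0 (1 : ℝ)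
  refine ⟨g, fun x hx => ?_⟩
  obtain ⟨r, hr, hrx⟩ := hopen x hx (-e)
  have := hgs _ hrx
  rw [map_add, map_neg, map_smul, hge, Rat.smul_def] at this
  have hr' : 0 < (r : ℝ) := by exact_mod_cast hr
  by_contra! hneg
  nlinarith

end RieszExtensionRat

/-- Two families on `Fin n` that list the same multiset differ by a permutation. -/
theorem exists_perm_of_ofFn_perm {X : Type*} {n : ℕ} {x y : Fin n → X}
    (h : (List.ofFn x).Perm (List.ofFn y)) : ∃ σ : Equiv.Perm (Fin n), x = y ∘ σ := by
  classical
  have hm : Finset.univ.val.map x = Finset.univ.val.map y := by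
    rw [Fin.univ_val_map, Fin.univ_val_map]
    exact Multiset.coe_eq_coe.2 h
  have hcard (c : X) : Fintype.card {a // x a = c} = Fintype.card {b // y b = c} := by
    have := congrArg (Multiset.count c) hm
    rw [Multiset.count_map, Multiset.count_map] at this
    rw [Fintype.card_subtype, Fintype.card_subtype]
    simpa only [Finset.card_def, Finset.filter_val, eq_comm] using this
  refine ⟨Equiv.ofFiberEquiv fun c => Fintype.equivOfCardEq (hcard c), ?_⟩
  funext a
  exact (Equiv.ofFiberEquiv_map _ a).symm

section Separation

variable {X : Type*}

/-- The vector of multiplicities of a multiset. -/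
noncomputable def multiplicityVector : Multiset X →+ (X →₀ ℚ) :=
  Multiset.sumAddMonoidHom.comp (Multiset.mapAddMonoidHom fun x => Finsupp.single x 1)

theorem multiplicityVector_eq (s : Multiset X) :
    multiplicityVector s = (s.map fun x => Finsupp.single x (1 : ℚ)).sum := rfl

theorem multiplicityVector_singleton (x : X) :
    multiplicityVector {x} = Finsupp.single x 1 := by
  simp [multiplicityVector_eq]

theorem multiplicityVector_injective :
    Function.Injective (multiplicityVector : Multiset X → X →₀ ℚ) := by
  classical
  have key (s : Multiset X) (x : X) : multiplicityVector s x = s.count x := by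
    induction s using Multiset.induction_on with
    | empty => simp
    | cons a s ih =>
      rw [← Multiset.singleton_add, map_add, Finsupp.add_apply, ih, multiplicityVector_singleton,
        Multiset.count_add, Multiset.count_singleton, Finsupp.single_apply]
      simp [eq_comm]
  intro s t h
  ext x
  have := DFunLike.congr_fun h x
  rw [key, key] at this
  exact_mod_cast this

/-- A set of multisets closed under addition and absorbing every element after sufficient
repetition. -/
structure IsOpenAddClosed (A : Set (Multiset X)) : Prop where
  add_mem : ∀ a ∈ A, ∀ b ∈ A, a + b ∈ A
  absorb : ∀ a ∈ A, ∀ y : X, ∃ n : ℕ, 0 < n ∧ n • a + {y} ∈ A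

theorem IsOpenAddClosed.nsmul_mem {A : Set (Multiset X)} (hA : IsOpenAddClosed A)
    {a : Multiset X} (ha : a ∈ A) {n : ℕ} (hn : 0 < n) : n • a ∈ A := by
  induction n, hn using Nat.le_induction with
  | base => simpa using ha
  | succ n _ ih => rw [succ_nsmul]; exact hA.add_mem _ ih _ ha

/-- The cone generated by differences of elements of `A` and `B`. -/
def diffCone {A B : Set (Multiset X)} (hA : IsOpenAddClosed A) (hB : IsOpenAddClosed B) :
    ConvexCone ℚ (X →₀ ℚ) where
  carrier := {v | ∃ n : ℕ, 0 < n ∧ ∃ a ∈ A, ∃ b ∈ B,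
    n • v = multiplicityVector a - multiplicityVector b}
  smul_mem' := by
    rintro c hc v ⟨n, hn, a, ha, b, hb, h⟩
    have hnum : 0 < c.num.toNat := by have := Rat.num_pos.2 hc; omega
    refine ⟨c.den * n, Nat.mul_pos c.den_pos hn, c.num.toNat • a, hA.nsmul_mem ha hnum,
      c.num.toNat • b, hB.nsmul_mem hb hnum, ?_⟩
    have hcd : (c.den : ℚ) * c = (c.num.toNat : ℚ) := by
      have h1 : ((c.num.toNat : ℤ) : ℚ) = (c.num : ℚ) := by
        rw [Int.toNat_of_nonneg (Rat.num_pos.2 hc).le]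
      rw [mul_comm, Rat.mul_den_eq_num, ← h1, Int.cast_natCast]
    rw [map_nsmul, map_nsmul, ← nsmul_sub, ← h]
    simp only [← Nat.cast_smul_eq_nsmul ℚ, smul_smul]
    congr 1
    rw [← hcd]
    push_cast
    ring
  add_mem' := by
    rintro v ⟨n, hn, a, ha, b, hb, h⟩ w ⟨k, hk, c, hc, d, hd, h'⟩
    refine ⟨n * k, Nat.mul_pos hn hk, k • a + n • c,
      hA.add_mem _ (hA.nsmul_mem ha hk) _ (hA.nsmul_mem hc hn), k • b + n • d,
      hB.add_mem _ (hB.nsmul_mem hb hk) _ (hB.nsmul_mem hd hn), ?_⟩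
    have e : (n * k) • (v + w) = k • (n • v) + n • (k • w) := by
      simp only [smul_add, smul_smul, mul_comm]
    rw [e, h, h']
    simp only [map_add, map_nsmul, nsmul_sub]
    abel

theorem sub_mem_diffCone {A B : Set (Multiset X)} (hA : IsOpenAddClosed A)
    (hB : IsOpenAddClosed B) {a b : Multiset X} (ha : a ∈ A) (hb : b ∈ B) :
    multiplicityVector a - multiplicityVector b ∈ diffCone hA hB :=
  ⟨1, one_pos, a, ha, b, hb, one_nsmul _⟩

theorem diffCone_open {A B : Set (Multiset X)} (hA : IsOpenAddClosed A)
    (hB : IsOpenAddClosed B) {v : X →₀ ℚ} (hv : v ∈ diffCone hA hB) (y : X →₀ ℚ) :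
    ∃ r : ℚ, 0 < r ∧ r • v + y ∈ diffCone hA hB := by
  induction y using Finsupp.induction_linear with
  | zero => exact ⟨1, one_pos, by simpa using hv⟩
  | add y z hy hz =>
    obtain ⟨r, hr, hry⟩ := hy
    obtain ⟨q, hq, hqz⟩ := hz
    refine ⟨r + q, add_pos hr hq, ?_⟩
    have := (diffCone hA hB).add_mem hry hqz
    rwa [add_add_add_comm, ← add_smul] at this
  | single x q =>
    obtain ⟨n, hn, a, ha, b, hb, h⟩ := hv
    have hn' : (0 : ℚ) < n := by exact_mod_cast hn
    rcases lt_trichotomy q 0 with hq | rfl | hq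
    · obtain ⟨k, hk, hkb⟩ := hB.absorb b hb x
      have hk' : (0 : ℚ) < k := by exact_mod_cast hk
      refine ⟨-q * (k * n), mul_pos (neg_pos.2 hq) (mul_pos hk' hn'), ?_⟩
      have := (diffCone hA hB).smul_mem (neg_pos.2 hq)
        (sub_mem_diffCone hA hB (hA.nsmul_mem ha hk) hkb)
      convert this using 1
      rw [map_add, map_nsmul, map_nsmul, multiplicityVector_singleton, ← sub_sub, ← nsmul_sub, ← h]
      simp only [← Nat.cast_smul_eq_nsmul ℚ, smul_smul, smul_sub, Finsupp.smul_single, smul_eq_mul]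
      simp [sub_eq_add_neg]
    · refine ⟨1, one_pos, ?_⟩
      simpa using ⟨n, hn, a, ha, b, hb, h⟩
    · obtain ⟨k, hk, hka⟩ := hA.absorb a ha x
      have hk' : (0 : ℚ) < k := by exact_mod_cast hk
      refine ⟨q * (k * n), mul_pos hq (mul_pos hk' hn'), ?_⟩
      have := (diffCone hA hB).smul_mem hq
        (sub_mem_diffCone hA hB hka (hB.nsmul_mem hb hk))
      convert this using 1
      rw [map_add, map_nsmul, map_nsmul, multiplicityVector_singleton, add_sub_right_comm,
        ← nsmul_sub, ← h]
      simp only [← Nat.cast_smul_eq_nsmul ℚ, smul_smul, smul_add, Finsupp.smul_single, smul_eq_mul,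
        mul_one]

/-- Disjoint open subsemigroups of the free commutative monoid, both meeting the generators, are
strictly separated by an additive functional. -/
theorem exists_separating_functional {A B : Set (Multiset X)} (hA : IsOpenAddClosed A)
    (hB : IsOpenAddClosed B) (hAB : Disjoint A B) {x y : X} (hx : {x} ∈ A) (hy : {y} ∈ B) :
    ∃ f : X → ℝ, (∀ a ∈ A, 0 < (a.map f).sum) ∧ ∀ b ∈ B, (b.map f).sum < 0 := by
  obtain ⟨g, hg⟩ := (diffCone hA hB).exists_pos_of_open (sub_mem_diffCone hA hB hx hy)
    (by
      rintro ⟨n, hn, a, ha, b, hb, h⟩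
      rw [smul_zero] at h
      have := multiplicityVector_injective (sub_eq_zero.1 h.symm)
      exact Set.disjoint_left.1 hAB ha (this ▸ hb))
    (fun v hv => diffCone_open hA hB hv)
  have hsub (a : Multiset X) (ha : a ∈ A) (b : Multiset X) (hb : b ∈ B) :
      g (multiplicityVector b) < g (multiplicityVector a) := by
    have := hg _ (sub_mem_diffCone hA hB ha hb)
    rwa [map_sub, sub_pos] at this
  have hAnonneg (a : Multiset X) (ha : a ∈ A) : 0 ≤ g (multiplicityVector a) := by
    by_contra! hneg
    obtain ⟨n, hn⟩ := exists_nat_gt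
      (g (multiplicityVector {y}) / g (multiplicityVector a))
    have h1 := hsub _ (hA.nsmul_mem ha n.succ_pos) _ hy
    rw [map_nsmul, map_nsmul, nsmul_eq_mul] at h1
    rw [div_lt_iff_of_neg hneg] at hn
    push_cast at h1
    nlinarith
  have hBnonpos (b : Multiset X) (hb : b ∈ B) : g (multiplicityVector b) ≤ 0 := by
    by_contra! hpos
    obtain ⟨n, hn⟩ := exists_nat_gt
      (g (multiplicityVector {x}) / g (multiplicityVector b))
    have h1 := hsub _ hx _ (hB.nsmul_mem hb n.succ_pos)
    rw [map_nsmul, map_nsmul, nsmul_eq_mul] at h1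
    rw [div_lt_iff₀ hpos] at hn
    push_cast at h1
    nlinarith
  have hsum (s : Multiset X) :
      (s.map fun z => g (Finsupp.single z 1)).sum = g (multiplicityVector s) := by
    rw [multiplicityVector_eq, map_multiset_sum, Multiset.map_map]
    rfl
  refine ⟨fun z => g (Finsupp.single z 1), fun a ha => ?_, fun b hb => ?_⟩
  · rw [hsum]
    refine (hAnonneg a ha).lt_of_ne' fun h0 => ?_
    obtain ⟨n, -, hn⟩ := hA.absorb a ha y
    have h1 := hAnonneg _ hn
    rw [map_add, map_add, map_nsmul, map_nsmul, h0, smul_zero, zero_add] at h1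
    have h2 := hsub a ha _ hy
    linarith
  · rw [hsum]
    refine (hBnonpos b hb).lt_of_ne fun h0 => ?_
    obtain ⟨n, -, hn⟩ := hB.absorb b hb x
    have h1 := hBnonpos _ hn
    rw [map_add, map_add, map_nsmul, map_nsmul, h0, smul_zero, zero_add] at h1
    have h2 := hsub _ hx b hb
    linarith

/-- An internal and asymptotically idempotent mean `μ` of multisets is, at each level `t` strictly
between two of its values on singletons, described by the sign of an additive functional. -/
theorem exists_sign_functional {μ : Multiset X → ℝ}
    (hint : ∀ a b, a ≠ 0 → b ≠ 0 → min (μ a) (μ b) ≤ μ (a + b) ∧ μ (a + b) ≤ max (μ a) (μ b))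
    (hlim : ∀ a, a ≠ 0 → ∀ y : X, Tendsto (fun n : ℕ => μ (n • a + {y})) atTop (𝓝 (μ a)))
    {t : ℝ} {x y : X} (hx : t < μ {x}) (hy : μ {y} < t) :
    ∃ f : X → ℝ, ∀ a, a ≠ 0 →
      (t < μ a → 0 < (a.map f).sum) ∧ (μ a < t → (a.map f).sum < 0) := by
  have hA : IsOpenAddClosed {a : Multiset X | a ≠ 0 ∧ t < μ a} :=
    { add_mem := fun a ha b hb =>
        ⟨by simp [ha.1], (lt_min ha.2 hb.2).trans_le (hint a b ha.1 hb.1).1⟩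
      absorb := fun a ha y => by
        obtain ⟨n, h1, h2⟩ :=
          (((hlim a ha.1 y).eventually (lt_mem_nhds ha.2)).and (eventually_gt_atTop 0)).exists
        exact ⟨n, h2, by simp, h1⟩ }
  have hB : IsOpenAddClosed {a : Multiset X | a ≠ 0 ∧ μ a < t} :=
    { add_mem := fun a ha b hb =>
        ⟨by simp [ha.1], (hint a b ha.1 hb.1).2.trans_lt (max_lt ha.2 hb.2)⟩
      absorb := fun a ha y => by
        obtain ⟨n, h1, h2⟩ :=
          (((hlim a ha.1 y).eventually (gt_mem_nhds ha.2)).and (eventually_gt_atTop 0)).exists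
        exact ⟨n, h2, by simp, h1⟩ }
  obtain ⟨f, h1, h2⟩ := exists_separating_functional hA hB
    (Set.disjoint_left.2 fun a ha hb => lt_asymm ha.2 hb.2) (x := x) (y := y)
    ⟨by simp, hx⟩ ⟨by simp, hy⟩
  exact ⟨f, fun a ha => ⟨fun h => h1 a ⟨ha, h⟩, fun h => h2 a ⟨ha, h⟩⟩⟩

end Separation

section Tuples

variable {X : Type*}

theorem coe_ofFn_repBlock {k : ℕ} (n : ℕ) (x : Fin k → X) :
    (List.ofFn (repBlock n x) : Multiset X) = n • (List.ofFn x : Multiset X) := by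
  rcases Nat.eq_zero_or_pos n with rfl | hn
  · simp
  rw [List.ofFn_mul]
  have h (i : Fin k) : (List.ofFn fun j : Fin n => repBlock n x ⟨i * n + j, by
      have := i.isLt; have := j.isLt; nlinarith⟩) = List.replicate n (x i) := by
    rw [← List.ofFn_const]
    congr 1
    funext j
    unfold repBlock
    congr 2
    change (i.val * n + j.val) / n = i.val
    rw [mul_comm, Nat.mul_add_div hn, Nat.div_eq_of_lt j.isLt, add_zero]
  simp only [h]
  clear h hn
  induction k with
  | zero => simp
  | succ k ih =>
    rw [List.ofFn_succ, List.ofFn_succ, List.flatten_cons, ← Multiset.coe_add, ih,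
      ← Multiset.cons_coe, ← Multiset.singleton_add, nsmul_add, Multiset.nsmul_singleton]
    rfl

theorem coe_ofFn_append_singleton_repBlock {k : ℕ} (n : ℕ) (x : Fin k → X) (y : X) :
    (List.ofFn (Fin.append (repBlock n x) fun _ : Fin 1 => y) : Multiset X)
      = n • (List.ofFn x : Multiset X) + {y} := by
  rw [List.ofFn_fin_append, ← Multiset.coe_add, coe_ofFn_repBlock]
  simp

theorem sum_append_repBlock {k : ℕ} (n : ℕ) (x : Fin k → X) (y : X) (f : X → ℝ) :
    ∑ i, f (Fin.append (repBlock n x) (fun _ : Fin 1 => y) i) = n * ∑ i, f (x i) + f y := by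
  have key (m : ℕ) (z : Fin m → X) :
      ∑ i, f (z i) = (((List.ofFn z : Multiset X)).map f).sum := by
    simp [List.sum_ofFn]
  rw [key, coe_ofFn_append_singleton_repBlock, key, Multiset.map_add, Multiset.map_nsmul]
  simp [Multiset.sum_nsmul]

/-- A family of symmetric functions of tuples factors through multisets. -/
theorem exists_multiset_mean (M : ∀ n : ℕ, (Fin n → X) → ℝ)
    (hsymm : ∀ n : ℕ, 0 < n → ∀ (x : Fin n → X) (π : Equiv.Perm (Fin n)), M n (x ∘ π) = M n x) :
    ∃ μ : Multiset X → ℝ, ∀ n, 0 < n → ∀ x : Fin n → X, M n x = μ (List.ofFn x) := by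
  have key (n k : ℕ) (hn : 0 < n) (x : Fin n → X) (y : Fin k → X)
      (h : (List.ofFn x).Perm (List.ofFn y)) : M n x = M k y := by
    obtain rfl : n = k := by simpa using h.length_eq
    obtain ⟨σ, rfl⟩ := exists_perm_of_ofFn_perm h
    exact hsymm n hn y σ
  refine ⟨fun s => M s.toList.length s.toList.get, fun n hn x => key _ _ hn _ _ ?_⟩
  rw [List.ofFn_get, ← Multiset.coe_eq_coe, Multiset.coe_toList]

end Tuples

section Estimators

variable {X : Type*} {Θ : Set ℝ} {M : ∀ n : ℕ, (Fin n → X) → ℝ}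

theorem IsThetaEst.perm_eq {ψ : X → ℝ → ℝ} (hΘc : Θ.OrdConnected) {n : ℕ}
    (h : IsThetaEst Θ ψ n (M n)) (x : Fin n → X) (π : Equiv.Perm (Fin n)) :
    M n (x ∘ π) = M n x := by
  have hs (t : ℝ) : ∑ i, ψ ((x ∘ π) i) t = ∑ i, ψ (x i) t :=
    Equiv.sum_comp π fun i => ψ (x i) t
  obtain ⟨h1, h2, h3⟩ := h (x ∘ π)
  obtain ⟨h4, h5, h6⟩ := h x
  simp only [hs] at h2 h3
  rcases lt_trichotomy (M n (x ∘ π)) (M n x) with hlt | heq | hlt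
  · obtain ⟨t, ht1, ht2⟩ := exists_between hlt
    have ht := hΘc.out h1 h4 ⟨ht1.le, ht2.le⟩
    exact absurd (h3 t ht ht1) (h5 t ht ht2).not_gt
  · exact heq
  · obtain ⟨t, ht1, ht2⟩ := exists_between hlt
    have ht := hΘc.out h4 h1 ⟨ht1.le, ht2.le⟩
    exact absurd (h6 t ht ht1) (h2 t ht ht2).not_gt

theorem IsThetaEst.internal {ψ : X → ℝ → ℝ} (hΘc : Θ.OrdConnected) {n k : ℕ}
    (hn : IsThetaEst Θ ψ n (M n)) (hk : IsThetaEst Θ ψ k (M k))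
    (hnk : IsThetaEst Θ ψ (n + k) (M (n + k))) (x : Fin n → X) (y : Fin k → X) :
    min (M n x) (M k y) ≤ M (n + k) (Fin.append x y) ∧
      M (n + k) (Fin.append x y) ≤ max (M n x) (M k y) := by
  obtain ⟨h1, h2, h3⟩ := hn x
  obtain ⟨h4, h5, h6⟩ := hk y
  obtain ⟨h7, h8, h9⟩ := hnk (Fin.append x y)
  simp only [Fin.sum_univ_add, Fin.append_left, Fin.append_right] at h8 h9
  constructor
  · by_contra! hlt
    obtain ⟨t, ht1, ht2⟩ := exists_between hlt
    obtain ⟨ht3, ht4⟩ := lt_min_iff.1 ht2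
    have ht := hΘc.out h7 h1 ⟨ht1.le, ht3.le⟩
    linarith [h9 t ht ht1, h2 t ht ht3, h5 t ht ht4]
  · by_contra! hlt
    obtain ⟨t, ht1, ht2⟩ := exists_between hlt
    obtain ⟨ht3, ht4⟩ := max_lt_iff.1 ht1
    have ht := hΘc.out h1 h7 ⟨ht3.le, ht2.le⟩
    linarith [h8 t ht ht2, h3 t ht ht3, h6 t ht ht4]

theorem IsThetaEst.tendsto {ψ : X → ℝ → ℝ} (hΘo : IsOpen Θ)
    (h : ∀ n : ℕ, 0 < n → IsThetaEst Θ ψ n (M n)) {k : ℕ} (hk : 0 < k) (x : Fin k → X) (y : X) :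
    Tendsto (fun n : ℕ => M (k * n + 1) (Fin.append (repBlock n x) (fun _ : Fin 1 => y)))
      atTop (𝓝 (M k x)) := by
  obtain ⟨h1, h2, h3⟩ := h k hk x
  have hΘ := hΘo.mem_nhds h1
  refine tendsto_order.2 ⟨fun a ha => ?_, fun a ha => ?_⟩
  · obtain ⟨t, ht, hat, htM⟩ :=
      (Filter.Eventually.and (mem_nhdsWithin_of_mem_nhds hΘ) (Ioo_mem_nhdsLT ha)).exists
    have hpos := h2 t ht htM
    filter_upwards [((tendsto_natCast_atTop_atTop (R := ℝ)).atTop_mul_const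
      hpos).eventually_gt_atTop (-ψ y t)] with n hn
    refine hat.trans_le (not_lt.1 fun hlt => ?_)
    have := (h _ (Nat.succ_pos _) (Fin.append (repBlock n x) fun _ : Fin 1 => y)).2.2 t ht hlt
    rw [sum_append_repBlock n x y fun z => ψ z t] at this
    linarith
  · obtain ⟨t, ht, hMt, hta⟩ :=
      (Filter.Eventually.and (mem_nhdsWithin_of_mem_nhds hΘ) (Ioo_mem_nhdsGT ha)).exists
    have hneg := h3 t ht hMt
    filter_upwards [((tendsto_natCast_atTop_atTop (R := ℝ)).atTop_mul_const_of_neg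
      hneg).eventually_lt_atBot (-ψ y t)] with n hn
    refine lt_of_le_of_lt (not_lt.1 fun hlt => ?_) hta
    have := (h _ (Nat.succ_pos _) (Fin.append (repBlock n x) fun _ : Fin 1 => y)).2.1 t ht hlt
    rw [sum_append_repBlock n x y fun z => ψ z t] at this
    linarith

/-- If the one-variable estimator takes values in the open set `Θ`, then `ψ ∈ Ψ(X,Θ)`. -/
theorem IsThetaEst.psiClass {ψ : X → ℝ → ℝ} (hΘo : IsOpen Θ) (h : IsThetaEst Θ ψ 1 (M 1)) :
    PsiClass Θ ψ := by
  intro x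
  obtain ⟨h1, h2, h3⟩ := h fun _ => x
  have hΘ := hΘo.mem_nhds h1
  obtain ⟨s, hs, hsM⟩ :=
    (Filter.Eventually.and (mem_nhdsWithin_of_mem_nhds hΘ) self_mem_nhdsWithin :
      ∀ᶠ s in 𝓝[<] (M 1 fun _ => x), s ∈ Θ ∧ s < M 1 fun _ => x).exists
  obtain ⟨t, ht, hMt⟩ :=
    (Filter.Eventually.and (mem_nhdsWithin_of_mem_nhds hΘ) self_mem_nhdsWithin :
      ∀ᶠ t in 𝓝[>] (M 1 fun _ => x), t ∈ Θ ∧ (M 1 fun _ => x) < t).exists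
  exact ⟨s, hs, t, ht, hsM.trans hMt, by simpa using h2 s hs hsM, by simpa using h3 t ht hMt⟩

/-- Symmetric, internal, asymptotically idempotent means whose one-variable values straddle every
point of `Θ` are generalized `ψ`-estimators. -/
theorem exists_isThetaEst (hMΘ : ∀ n : ℕ, 0 < n → ∀ x : Fin n → X, M n x ∈ Θ)
    (hlow : ∀ t ∈ Θ, ∃ y : X, M 1 (fun _ => y) < t)
    (hupp : ∀ t ∈ Θ, ∃ x : X, t < M 1 (fun _ => x))
    (hsymm : ∀ n : ℕ, 0 < n → ∀ (x : Fin n → X) (π : Equiv.Perm (Fin n)), M n (x ∘ π) = M n x)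
    (hint : ∀ n k : ℕ, 0 < n → 0 < k → ∀ (x : Fin n → X) (y : Fin k → X),
      min (M n x) (M k y) ≤ M (n + k) (Fin.append x y) ∧
        M (n + k) (Fin.append x y) ≤ max (M n x) (M k y))
    (hlim : ∀ k : ℕ, 0 < k → ∀ (x : Fin k → X) (y : X),
      Tendsto (fun n : ℕ => M (k * n + 1) (Fin.append (repBlock n x) (fun _ : Fin 1 => y)))
        atTop (𝓝 (M k x))) :
    ∃ ψ : X → ℝ → ℝ, ∀ n : ℕ, 0 < n → IsThetaEst Θ ψ n (M n) := by
  obtain ⟨μ, hμ⟩ := exists_multiset_mean M hsymm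
  have hrep (a : Multiset X) (ha : a ≠ 0) :
      ∃ n, 0 < n ∧ ∃ x : Fin n → X, (List.ofFn x : Multiset X) = a := by
    refine ⟨a.toList.length, ?_, a.toList.get, by rw [List.ofFn_get, Multiset.coe_toList]⟩
    rw [Multiset.length_toList]
    exact Multiset.card_pos.2 ha
  have hμint (a b : Multiset X) (ha : a ≠ 0) (hb : b ≠ 0) :
      min (μ a) (μ b) ≤ μ (a + b) ∧ μ (a + b) ≤ max (μ a) (μ b) := by
    obtain ⟨n, hn, x, rfl⟩ := hrep a ha
    obtain ⟨k, hk, y, rfl⟩ := hrep b hb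
    have := hint n k hn hk x y
    rwa [hμ _ hn, hμ _ hk, hμ _ (Nat.add_pos_left hn k), List.ofFn_fin_append,
      ← Multiset.coe_add] at this
  have hμlim (a : Multiset X) (ha : a ≠ 0) (y : X) :
      Tendsto (fun n : ℕ => μ (n • a + {y})) atTop (𝓝 (μ a)) := by
    obtain ⟨k, hk, x, rfl⟩ := hrep a ha
    have := hlim k hk x y
    rw [hμ _ hk] at this
    refine this.congr fun n => ?_
    rw [hμ _ (Nat.succ_pos _), coe_ofFn_append_singleton_repBlock]
  have hμ1 (x : X) : M 1 (fun _ => x) = μ {x} := by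
    rw [hμ 1 one_pos]
    simp
  have hex (t : ℝ) : ∃ f : X → ℝ, t ∈ Θ → ∀ a : Multiset X, a ≠ 0 →
      (t < μ a → 0 < (a.map f).sum) ∧ (μ a < t → (a.map f).sum < 0) := by
    by_cases ht : t ∈ Θ
    · obtain ⟨y, hy⟩ := hlow t ht
      obtain ⟨x, hx⟩ := hupp t ht
      rw [hμ1] at hx hy
      obtain ⟨f, hf⟩ := exists_sign_functional hμint hμlim hx hy
      exact ⟨f, fun _ => hf⟩
    · exact ⟨0, fun h => absurd h ht⟩
  choose f hf using hex
  refine ⟨fun x t => f t x, fun n hn x => ⟨hMΘ n hn x, ?_⟩⟩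
  have hne : (List.ofFn x : Multiset X) ≠ 0 := by
    rw [← Multiset.card_pos]
    simpa using hn
  have hsum (t : ℝ) : ∑ i, f t (x i) = ((List.ofFn x : Multiset X).map (f t)).sum := by
    simp [List.sum_ofFn]
  simp only [hsum]
  rw [hμ n hn]
  exact ⟨fun t ht => (hf t ht _ hne).1, fun t ht => (hf t ht _ hne).2⟩

end Estimators

/-- Axiomatic characterisation of generalized ψ-estimators
(Barczy–Pálés, Theorem 2.8 / `Thm_charac_psi_est`). -/
theorem charac_generalized_psi_estimators
    {X : Type*} [Nonempty X] (Θ : Set ℝ)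
    (hΘo : IsOpen Θ) (hΘc : Θ.OrdConnected) (hΘnd : ∃ s ∈ Θ, ∃ t ∈ Θ, s < t)
    (M : ∀ n : ℕ, (Fin n → X) → ℝ)
    (hMΘ : ∀ n : ℕ, 0 < n → ∀ x : Fin n → X, M n x ∈ Θ)
    (hinf : sInf (Set.range fun x : X => (M 1 (fun _ => x) : EReal))
        = sInf (Real.toEReal '' Θ))
    (hsup : sSup (Set.range fun x : X => (M 1 (fun _ => x) : EReal))
        = sSup (Real.toEReal '' Θ)) :
    (∃ ψ : X → ℝ → ℝ, PsiClass Θ ψ ∧ ∀ n : ℕ, 0 < n → IsThetaEst Θ ψ n (M n)) ↔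
      ((∀ n : ℕ, 0 < n → ∀ (x : Fin n → X) (π : Equiv.Perm (Fin n)),
          M n (x ∘ π) = M n x) ∧
       (∀ n k : ℕ, 0 < n → 0 < k → ∀ (x : Fin n → X) (y : Fin k → X),
          min (M n x) (M k y) ≤ M (n + k) (Fin.append x y) ∧
          M (n + k) (Fin.append x y) ≤ max (M n x) (M k y)) ∧
       (∀ k : ℕ, 0 < k → ∀ (x : Fin k → X) (y : X),
          Tendsto (fun n : ℕ =>
              M (k * n + 1) (Fin.append (repBlock n x) (fun _ : Fin 1 => y)))
            atTop (𝓝 (M k x)))) := by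
  constructor
  · rintro ⟨ψ, -, h⟩
    exact ⟨fun n hn => (h n hn).perm_eq hΘc,
      fun n k hn hk => (h n hn).internal hΘc (h k hk) (h _ (Nat.add_pos_left hn k)),
      fun k hk => IsThetaEst.tendsto hΘo h hk⟩
  · rintro ⟨hsymm, hint, hlim⟩
    have hlow : ∀ t ∈ Θ, ∃ y : X, M 1 (fun _ => y) < t := by
      intro t ht
      obtain ⟨s, hs, hst⟩ := (Filter.Eventually.and
        (mem_nhdsWithin_of_mem_nhds (hΘo.mem_nhds ht)) self_mem_nhdsWithin :
          ∀ᶠ s in 𝓝[<] t, s ∈ Θ ∧ s < t).exists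
      have hlt : sInf (Real.toEReal '' Θ) < (t : EReal) :=
        sInf_lt_iff.2 ⟨s, ⟨s, hs, rfl⟩, EReal.coe_lt_coe_iff.2 hst⟩
      rw [← hinf] at hlt
      obtain ⟨_, ⟨y, rfl⟩, hy⟩ := sInf_lt_iff.1 hlt
      exact ⟨y, EReal.coe_lt_coe_iff.1 hy⟩
    have hupp : ∀ t ∈ Θ, ∃ x : X, t < M 1 (fun _ => x) := by
      intro t ht
      obtain ⟨s, hs, hst⟩ := (Filter.Eventually.and
        (mem_nhdsWithin_of_mem_nhds (hΘo.mem_nhds ht)) self_mem_nhdsWithin :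
          ∀ᶠ s in 𝓝[>] t, s ∈ Θ ∧ t < s).exists
      have hlt : (t : EReal) < sSup (Real.toEReal '' Θ) :=
        lt_sSup_iff.2 ⟨s, ⟨s, hs, rfl⟩, EReal.coe_lt_coe_iff.2 hst⟩
      rw [← hsup] at hlt
      obtain ⟨_, ⟨x, rfl⟩, hx⟩ := lt_sSup_iff.1 hlt
      exact ⟨x, EReal.coe_lt_coe_iff.1 hx⟩
    obtain ⟨ψ, hψ⟩ := exists_isThetaEst hMΘ hlow hupp hsymm hint hlim
    exact ⟨ψ, (hψ 1 one_pos).psiClass hΘo, hψ⟩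
end

section
/- Let X be a nonempty set, Θ a nondegenerate open interval of ℝ, and M : ⋃_{n≥1} Xⁿ → Θ a function (with M_n its restriction to Xⁿ) such that inf M₁(X) = inf Θ and sup M₁(X) = sup Θ. Then the following are equivalent: (i) there exists a function ψ ∈ Ψ(X,Θ) possessing properties [Z] and [C] such that ϑ_{n,ψ}(x₁,…,xₙ) = M_n(x₁,…,xₙ) for all n ∈ ℕ and x₁,…,xₙ ∈ X; (ii) M is symmetric (M_n(x₁,…,xₙ) = M_n(x_{π(1)},…,x_{π(n)}) for every permutation π), strictly internal (min(M_n(x₁,…,xₙ), M_k(y₁,…,y_k)) ≤ M_{n+k}(x₁,…,xₙ,y₁,…,y_k) ≤ max(M_n(x₁,…,xₙ), M_k(y₁,…,y_k)) for all n,k and all arguments, with both inequalities strict whenever M_n(x₁,…,xₙ) ≠ M_k(y₁,…,y_k)), and asymptotically idempotent (for all k ∈ ℕ and x₁,…,x_k, y ∈ X, M_{kn+1}(x₁,…,x₁,…,x_k,…,x_k,y), with each xᵢ repeated n times, converges to M_k(x₁,…,x_k) as n → ∞). -/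
open Filter Topology

theorem le_of_forall_natCast_mul_le {x y c : ℝ} (h : ∀ n : ℕ, n * x ≤ n * y + c) : x ≤ y := by
  by_contra! hlt
  obtain ⟨n, hn⟩ := exists_nat_gt (c / (x - y))
  rw [div_lt_iff₀ (sub_pos.2 hlt)] at hn
  linarith [h n]

/-- A function on a commutative monoid whose sign is strictly additive and Archimedean. -/
structure IsArchSign {A : Type*} [AddCommMonoid A] (l : A → ℝ) : Prop where
  map_zero : l 0 = 0
  add_nonneg : ∀ u v, 0 ≤ l u → 0 ≤ l v → 0 ≤ l (u + v)
  add_nonpos : ∀ u v, l u ≤ 0 → l v ≤ 0 → l (u + v) ≤ 0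
  add_pos : ∀ u v, 0 < l u → 0 ≤ l v → 0 < l (u + v)
  add_neg : ∀ u v, l u < 0 → l v ≤ 0 → l (u + v) < 0
  exists_pos : ∀ u v, 0 < l u → ∃ n : ℕ, 0 < l (n • u + v)
  exists_neg : ∀ u v, l u < 0 → ∃ n : ℕ, l (n • u + v) < 0

/-- The real number `h` is the value of `u` relative to `a`: it is the threshold at which
`q • u + p • a` changes sign. -/
def IsCutValue {A : Type*} [AddCommMonoid A] (l : A → ℝ) (a u : A) (h : ℝ) : Prop :=
  ∀ p q : ℕ, 0 < q →
    (0 < l (q • u + p • a) → (p : ℝ) < q * h) ∧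
    (l (q • u + p • a) = 0 → (p : ℝ) = q * h) ∧
    (l (q • u + p • a) < 0 → q * h < p)

/-- `f` is additive and has the same sign as `l`. -/
def IsAddSign {A : Type*} [AddCommMonoid A] (l f : A → ℝ) : Prop :=
  (∀ u v, f (u + v) = f u + f v) ∧
    ∀ u, (0 < l u → 0 < f u) ∧ (l u = 0 → f u = 0) ∧ (l u < 0 → f u < 0)

namespace IsArchSign

variable {A : Type*} [AddCommMonoid A] {l : A → ℝ}

theorem nsmul_nonneg (hl : IsArchSign l) {u : A} (hu : 0 ≤ l u) (n : ℕ) : 0 ≤ l (n • u) := by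
  induction n with
  | zero => simp [hl.map_zero]
  | succ n ih => rw [succ_nsmul]; exact hl.add_nonneg _ _ ih hu

theorem nsmul_nonpos (hl : IsArchSign l) {u : A} (hu : l u ≤ 0) (n : ℕ) : l (n • u) ≤ 0 := by
  induction n with
  | zero => simp [hl.map_zero]
  | succ n ih => rw [succ_nsmul]; exact hl.add_nonpos _ _ ih hu

theorem nsmul_pos (hl : IsArchSign l) {u : A} (hu : 0 < l u) {n : ℕ} (hn : 0 < n) :
    0 < l (n • u) := by
  obtain ⟨n, rfl⟩ := Nat.exists_eq_add_of_lt hn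
  rw [zero_add, succ_nsmul']
  exact hl.add_pos _ _ hu (hl.nsmul_nonneg hu.le n)

theorem nsmul_neg (hl : IsArchSign l) {u : A} (hu : l u < 0) {n : ℕ} (hn : 0 < n) :
    l (n • u) < 0 := by
  obtain ⟨n, rfl⟩ := Nat.exists_eq_add_of_lt hn
  rw [zero_add, succ_nsmul']
  exact hl.add_neg _ _ hu (hl.nsmul_nonpos hu.le n)

theorem exists_isCutValue (hl : IsArchSign l) {a u : A} (ha : l a < 0) (hu : 0 < l u) :
    ∃ h, IsCutValue l a u h := by
  set S : Set ℝ := {r | ∃ p q : ℕ, 0 < q ∧ 0 < l (q • u + p • a) ∧ r = p / q}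
  have upper : ∀ p q : ℕ, 0 < q → l (q • u + p • a) ≤ 0 → ∀ r ∈ S, r ≤ (p : ℝ) / q := by
    rintro p q hq hle r ⟨p', q', hq', hlt, rfl⟩
    rw [div_le_div_iff₀ (by exact_mod_cast hq') (by exact_mod_cast hq)]
    norm_cast
    by_contra! hcon
    obtain ⟨d, hd⟩ := Nat.exists_eq_add_of_lt hcon
    have h1 := hl.nsmul_pos hlt hq
    have h2 := hl.add_neg _ _ (hl.nsmul_neg ha (Nat.succ_pos d)) (hl.nsmul_nonpos hle q')
    have h3 : q • (q' • u + p' • a) = (d + 1) • a + q' • (q • u + p • a) := by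
      rw [smul_add, smul_add, smul_smul, smul_smul, smul_smul, smul_smul, mul_comm q p', hd,
        mul_comm q' q, mul_comm q' p, add_assoc (p * q') d 1, add_smul]
      abel
    rw [h3] at h1
    linarith
  have hne : S.Nonempty := ⟨0, 0, 1, one_pos, by simpa using hu, by simp⟩
  have hbdd : BddAbove S := by
    obtain ⟨n, hn⟩ := hl.exists_neg a u ha
    exact ⟨_, upper n 1 one_pos (by rw [one_smul, add_comm]; exact hn.le)⟩
  have lower : ∀ p q : ℕ, 0 < q → 0 < l (q • u + p • a) → (p : ℝ) ≤ q * sSup S := by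
    intro p q hq hlt
    have := le_csSup hbdd ⟨p, q, hq, hlt, rfl⟩
    rwa [div_le_iff₀' (by exact_mod_cast hq)] at this
  have upper' : ∀ p q : ℕ, 0 < q → l (q • u + p • a) ≤ 0 → q * sSup S ≤ p := by
    intro p q hq hle
    have := csSup_le hne (upper p q hq hle)
    rwa [le_div_iff₀' (by exact_mod_cast hq)] at this
  have pos : ∀ p q : ℕ, 0 < q → 0 < l (q • u + p • a) → (p : ℝ) < q * sSup S := by
    intro p q hq hlt
    obtain ⟨n, hn⟩ := hl.exists_pos _ a hlt
    have hn0 : 0 < n := by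
      rcases Nat.eq_zero_or_pos n with rfl | h
      · rw [zero_smul, zero_add] at hn; linarith
      · exact h
    have h1 : n • (q • u + p • a) + a = (n * q) • u + (n * p + 1) • a := by
      rw [smul_add, smul_smul, smul_smul, add_smul, one_smul, add_assoc]
    have := lower _ _ (Nat.mul_pos hn0 hq) (h1 ▸ hn)
    push_cast at this
    have hn' : (0 : ℝ) < n := by exact_mod_cast hn0
    by_contra! hcon
    nlinarith
  have hpos : 0 < sSup S := by simpa using pos 0 1 one_pos (by simpa using hu)
  have hshift (n p q : ℕ) : n • (q • u + p • a) + u = (n * q + 1) • u + (n * p) • a := by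
    rw [smul_add, smul_smul, smul_smul, add_smul, one_smul]
    abel
  refine ⟨sSup S, fun p q hq => ⟨pos p q hq, fun h0 => le_antisymm ?_ (upper' p q hq h0.le), ?_⟩⟩
  · refine le_of_forall_natCast_mul_le (c := sSup S) fun n => ?_
    have h1 : 0 < l (n • (q • u + p • a) + u) := by
      rw [add_comm]
      exact hl.add_pos _ _ hu (hl.nsmul_nonneg h0.ge n)
    have := lower _ _ (Nat.succ_pos _) (hshift n p q ▸ h1)
    push_cast at this
    linarith
  · intro hlt
    obtain ⟨n, hn⟩ := hl.exists_neg _ u hlt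
    have := upper' _ _ (Nat.succ_pos _) (hshift n p q ▸ hn.le)
    push_cast at this
    by_contra! hcon
    have : (n : ℝ) * p ≤ n * (q * sSup S) := by gcongr
    linarith

end IsArchSign

namespace IsCutValue

variable {A : Type*} [AddCommMonoid A] {l : A → ℝ} {a u v : A} {h h' k : ℝ}

theorem natCast_le_iff (hu : IsCutValue l a u h) {p q : ℕ} (hq : 0 < q) :
    (p : ℝ) ≤ q * h ↔ 0 ≤ l (q • u + p • a) := by
  obtain ⟨h1, h2, h3⟩ := hu p q hq
  rcases lt_trichotomy (l (q • u + p • a)) 0 with h | h | h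
  · exact iff_of_false (h3 h).not_ge h.not_ge
  · exact iff_of_true (h2 h).le h.ge
  · exact iff_of_true (h1 h).le h.le

theorem le_natCast_iff (hu : IsCutValue l a u h) {p q : ℕ} (hq : 0 < q) :
    q * h ≤ (p : ℝ) ↔ l (q • u + p • a) ≤ 0 := by
  obtain ⟨h1, h2, h3⟩ := hu p q hq
  rcases lt_trichotomy (l (q • u + p • a)) 0 with h | h | h
  · exact iff_of_true (h3 h).le h.le
  · exact iff_of_true (h2 h).ge h.le
  · exact iff_of_false (h1 h).not_ge h.not_ge

theorem pos (hu : IsCutValue l a u h) (hlu : 0 < l u) : 0 < h := by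
  simpa using (hu 0 1 one_pos).1 (by simpa using hlu)

theorem add (hl : IsArchSign l) (hu : IsCutValue l a u h) (hv : IsCutValue l a v k)
    (huv : IsCutValue l a (u + v) h') (hlu : 0 < l u) (hlv : 0 < l v) : h' = h + k := by
  have hh := hu.pos hlu
  have hk := hv.pos hlv
  have key (p p' q : ℕ) : q • (u + v) + (p + p') • a = (q • u + p • a) + (q • v + p' • a) := by
    rw [smul_add, add_smul]; abel
  apply le_antisymm
  · refine le_of_forall_natCast_mul_le (c := 2) fun q => ?_
    rcases Nat.eq_zero_or_pos q with rfl | hq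
    · simp
    have h1 := (hu.le_natCast_iff hq).1 (Nat.le_ceil (q * h))
    have h2 := (hv.le_natCast_iff hq).1 (Nat.le_ceil (q * k))
    have h3 := (huv.le_natCast_iff hq).2 (key _ _ q ▸ hl.add_nonpos _ _ h1 h2)
    have h4 := Nat.ceil_lt_add_one (a := (q : ℝ) * h) (by positivity)
    have h5 := Nat.ceil_lt_add_one (a := (q : ℝ) * k) (by positivity)
    push_cast at h3
    linarith
  · refine le_of_forall_natCast_mul_le (c := 2) fun q => ?_
    rcases Nat.eq_zero_or_pos q with rfl | hq
    · simp
    have h1 := (hu.natCast_le_iff hq).1 (Nat.floor_le (a := (q : ℝ) * h) (by positivity))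
    have h2 := (hv.natCast_le_iff hq).1 (Nat.floor_le (a := (q : ℝ) * k) (by positivity))
    have h3 := (huv.natCast_le_iff hq).2 (key _ _ q ▸ hl.add_nonneg _ _ h1 h2)
    have h4 := Nat.lt_floor_add_one ((q : ℝ) * h)
    have h5 := Nat.lt_floor_add_one ((q : ℝ) * k)
    push_cast at h3
    linarith

theorem add_of_nonpos (hl : IsArchSign l) (hu : IsCutValue l a u h)
    (huv : IsCutValue l a (u + v) h') (hlu : 0 < l u) (hlv : l v ≤ 0) : h' ≤ h := by
  have hh := hu.pos hlu
  refine le_of_forall_natCast_mul_le (c := 1) fun q => ?_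
  rcases Nat.eq_zero_or_pos q with rfl | hq
  · simp
  have h1 := (hu.le_natCast_iff hq).1 (Nat.le_ceil (q * h))
  have h2 : l (q • (u + v) + ⌈(q : ℝ) * h⌉₊ • a) ≤ 0 := by
    rw [smul_add, add_right_comm]
    exact hl.add_nonpos _ _ h1 (hl.nsmul_nonpos hlv q)
  have h3 := (huv.le_natCast_iff hq).2 h2
  have h4 := Nat.ceil_lt_add_one (a := (q : ℝ) * h) (by positivity)
  linarith

theorem add_of_nonneg (hl : IsArchSign l) (hu : IsCutValue l a u h)
    (huv : IsCutValue l a (u + v) h') (hlu : 0 < l u) (hlv : 0 ≤ l v) : h ≤ h' := by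
  have hh := hu.pos hlu
  refine le_of_forall_natCast_mul_le (c := 1) fun q => ?_
  rcases Nat.eq_zero_or_pos q with rfl | hq
  · simp
  have h1 := (hu.natCast_le_iff hq).1 (Nat.floor_le (a := (q : ℝ) * h) (by positivity))
  have h2 : 0 ≤ l (q • (u + v) + ⌊(q : ℝ) * h⌋₊ • a) := by
    rw [smul_add, add_right_comm]
    exact hl.add_nonneg _ _ h1 (hl.nsmul_nonneg hlv q)
  have h3 := (huv.natCast_le_iff hq).2 h2
  have h4 := Nat.lt_floor_add_one ((q : ℝ) * h)
  linarith

theorem add_base (hu : IsCutValue l a u h) (hua : IsCutValue l a (u + a) h')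
    (hlu : 0 < l u) (hlua : 0 < l (u + a)) : h' = h - 1 := by
  have hh := hu.pos hlu
  have hh' := hua.pos hlua
  have key (p q : ℕ) : q • (u + a) + p • a = q • u + (p + q) • a := by
    rw [smul_add, add_smul]; abel
  apply le_antisymm
  · refine le_of_forall_natCast_mul_le (c := 1) fun q => ?_
    rcases Nat.eq_zero_or_pos q with rfl | hq
    · simp
    have h1 := (hua.natCast_le_iff hq).1 (Nat.floor_le (a := (q : ℝ) * h') (by positivity))
    rw [key] at h1
    have h3 := (hu.natCast_le_iff hq).2 h1
    have h4 := Nat.lt_floor_add_one ((q : ℝ) * h')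
    push_cast at h3
    linarith
  · refine le_of_forall_natCast_mul_le (c := 1) fun q => ?_
    rcases Nat.eq_zero_or_pos q with rfl | hq
    · simp
    have h1 := (hua.le_natCast_iff hq).1 (Nat.le_ceil (q * h'))
    rw [key] at h1
    have h3 := (hu.le_natCast_iff hq).2 h1
    have h4 := Nat.ceil_lt_add_one (a := (q : ℝ) * h') (by positivity)
    push_cast at h3
    linarith

end IsCutValue

theorem IsAddSign.map_zero {A : Type*} [AddCommMonoid A] {l f : A → ℝ} (hf : IsAddSign l f) :
    f 0 = 0 := by
  simpa using hf.1 0 0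

theorem IsAddSign.map_nsmul {A : Type*} [AddCommMonoid A] {l f : A → ℝ} (hf : IsAddSign l f)
    (n : ℕ) (u : A) : f (n • u) = n * f u := by
  induction n with
  | zero => simp [hf.map_zero]
  | succ n ih => rw [succ_nsmul, hf.1, ih]; push_cast; ring

theorem IsArchSign.exists_isAddSign {A : Type*} [AddCommMonoid A] {l : A → ℝ}
    (hl : IsArchSign l) {a b : A} (ha : l a < 0) (hb : 0 < l b) :
    ∃ f, IsAddSign l f ∧ f a = -1 := by
  have hcut (u : A) : ∃ h, 0 < l u → IsCutValue l a u h := by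
    by_cases hu : 0 < l u
    · exact (hl.exists_isCutValue ha hu).imp fun _ h _ => h
    · exact ⟨0, fun h => absurd h hu⟩
  choose h hh using hcut
  have h_add {u v : A} (hu : 0 < l u) (hv : 0 < l v) : h (u + v) = h u + h v :=
    (hh u hu).add hl (hh v hv) (hh _ (hl.add_pos _ _ hu hv.le)) hu hv
  have hbn {n : ℕ} (hn : 0 < n) : 0 < l (n • b) := hl.nsmul_pos hb hn
  have h_nsmul (n : ℕ) : h ((n + 1) • b) = (n + 1) * h b := by
    induction n with
    | zero => simp
    | succ n ih =>
      rw [succ_nsmul, h_add (hbn n.succ_pos) hb, ih]; push_cast; ring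
  have hK (u : A) : ∃ K : ℕ, 0 < l ((K + 1) • b + u) := by
    obtain ⟨n, hn⟩ := hl.exists_pos b u hb
    refine ⟨n, ?_⟩
    rw [succ_nsmul', add_assoc]
    exact hl.add_pos _ _ hb hn.le
  choose K hK using hK
  set f : A → ℝ := fun u => h ((K u + 1) • b + u) - (K u + 1) * h b with hf
  have f_add (u v : A) : f (u + v) = f u + f v := by
    have e : ((K u + 1) • b + u) + ((K v + 1) • b + v) + (K (u + v) + 1) • b
        = ((K (u + v) + 1) • b + (u + v)) + (K u + K v + 1 + 1) • b := by
      simp only [add_smul, one_smul]; abel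
    have e' := congrArg h e
    rw [h_add (hl.add_pos _ _ (hK u) (hK v).le) (hbn (Nat.succ_pos _)), h_add (hK u) (hK v),
      h_add (hK _) (hbn (Nat.succ_pos _)), h_nsmul, h_nsmul] at e'
    push_cast at e'
    simp only [hf]
    linarith
  have f_nsmul (n : ℕ) (u : A) : f (n • u) = n * f u := by
    induction n with
    | zero => simpa using f_add 0 0
    | succ n ih => rw [succ_nsmul, f_add, ih]; push_cast; ring
  have f_nonpos {u : A} (hu : l u ≤ 0) : f u ≤ 0 := by
    have := (hh _ (hbn (K u).succ_pos)).add_of_nonpos hl (hh _ (hK u)) (hbn (K u).succ_pos) hu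
    rw [Nat.succ_eq_add_one, h_nsmul] at this
    simpa [hf] using this
  have f_nonneg {u : A} (hu : 0 ≤ l u) : 0 ≤ f u := by
    have := (hh _ (hbn (K u).succ_pos)).add_of_nonneg hl (hh _ (hK u)) (hbn (K u).succ_pos) hu
    rw [Nat.succ_eq_add_one, h_nsmul] at this
    simpa [hf] using this
  have f_a : f a = -1 := by
    have := (hh _ (hbn (K a).succ_pos)).add_base (hh _ (hK a)) (hbn (K a).succ_pos) (hK a)
    rw [Nat.succ_eq_add_one, h_nsmul] at this
    simp only [hf, this]
    ring
  have f_pos {u : A} (hu : 0 < l u) : 0 < f u := by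
    obtain ⟨n, hn⟩ := hl.exists_pos u a hu
    have := f_nonneg hn.le
    rw [f_add, f_nsmul, f_a] at this
    by_contra! hcon
    nlinarith [n.cast_nonneg (α := ℝ)]
  have f_neg {u : A} (hu : l u < 0) : f u < 0 := by
    obtain ⟨n, hn⟩ := hl.exists_neg u b hu
    have := f_nonpos hn.le
    have hfb := f_pos hb
    rw [f_add, f_nsmul] at this
    by_contra! hcon
    nlinarith [n.cast_nonneg (α := ℝ)]
  exact ⟨f, ⟨f_add, fun u => ⟨f_pos, fun h0 => le_antisymm (f_nonpos h0.le) (f_nonneg h0.ge),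
    f_neg⟩⟩, f_a⟩

theorem IsAddSign.continuousOn_of_pos {A T : Type*} [AddCommMonoid A] [TopologicalSpace T]
    {l f : T → A → ℝ} {U : Set T} {a u : A} (hc : ∀ v, Continuous fun t => l t v)
    (hf : ∀ t ∈ U, IsAddSign (l t) (f t)) (hfa : ∀ t ∈ U, f t a = -1)
    (hu : ∀ t ∈ U, 0 < l t u) : ContinuousOn (fun t => f t u) U := by
  have pos_of {t : T} (ht : t ∈ U) {v : A} (hv : 0 < f t v) : 0 < l t v := by
    obtain ⟨-, h2, h3⟩ := (hf t ht).2 v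
    by_contra! hcon
    rcases hcon.lt_or_eq with h | h
    · linarith [h3 h]
    · linarith [h2 h]
  have neg_of {t : T} (ht : t ∈ U) {v : A} (hv : f t v < 0) : l t v < 0 := by
    obtain ⟨h1, h2, -⟩ := (hf t ht).2 v
    by_contra! hcon
    rcases hcon.lt_or_eq with h | h
    · linarith [h1 h]
    · linarith [h2 h.symm]
  have val {t : T} (ht : t ∈ U) (p q : ℕ) : f t (q • u + p • a) = q * f t u - p := by
    rw [(hf t ht).1, (hf t ht).map_nsmul, (hf t ht).map_nsmul, hfa t ht]; ring
  have rat_eq {r : ℚ} (hr : 0 < r) :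
      (r : ℝ) = (r.num.toNat : ℝ) / r.den ∧ (0 : ℝ) < r.den := by
    have h1 : ((r.num.toNat : ℤ) : ℝ) = (r.num : ℝ) := by
      rw [Int.toNat_of_nonneg (Rat.num_pos.2 hr).le]
    rw [Int.cast_natCast] at h1
    refine ⟨?_, by exact_mod_cast r.den_pos⟩
    rw [h1]
    exact Rat.cast_def r
  intro t₀ ht₀
  have hpos := ((hf t₀ ht₀).2 u).1 (hu t₀ ht₀)
  refine tendsto_order.2 ⟨fun c hlt => ?_, fun c hlt => ?_⟩
  · obtain ⟨r, hr1, hr2⟩ := exists_rat_btwn (max_lt hlt hpos)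
    obtain ⟨hr, hden⟩ := rat_eq (r := r) (by exact_mod_cast (le_max_right c 0).trans_lt hr1)
    rw [hr, div_lt_iff₀' hden] at hr2
    have h0 := pos_of ht₀ (v := r.den • u + r.num.toNat • a) (by rw [val ht₀]; linarith)
    filter_upwards [mem_nhdsWithin_of_mem_nhds ((hc _).continuousAt.eventually_const_lt h0),
      self_mem_nhdsWithin] with t h1 ht
    have h2 := ((hf t ht).2 _).1 h1
    rw [val ht, sub_pos, ← div_lt_iff₀' hden, ← hr] at h2
    exact (le_max_left c 0).trans_lt (hr1.trans h2)
  · obtain ⟨r, hr1, hr2⟩ := exists_rat_btwn hlt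
    obtain ⟨hr, hden⟩ := rat_eq (r := r) (by exact_mod_cast hpos.trans hr1)
    rw [hr, lt_div_iff₀' hden] at hr1
    have h0 := neg_of ht₀ (v := r.den • u + r.num.toNat • a) (by rw [val ht₀]; linarith)
    filter_upwards [mem_nhdsWithin_of_mem_nhds ((hc _).continuousAt.eventually_lt_const h0),
      self_mem_nhdsWithin] with t h1 ht
    have h2 := ((hf t ht).2 _).2.2 h1
    rw [val ht, sub_neg, ← lt_div_iff₀' hden, ← hr] at h2
    exact h2.trans hr2

theorem IsAddSign.convex {A : Type*} [AddCommMonoid A] (l : A → ℝ) :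
    Convex ℝ {f : A → ℝ | IsAddSign l f} := by
  intro f hf g hg α β hα hβ hαβ
  refine ⟨fun u v => ?_, fun u => ⟨fun h => ?_, fun h => ?_, fun h => ?_⟩⟩
  · simp only [Pi.add_apply, Pi.smul_apply, smul_eq_mul, hf.1 u v, hg.1 u v]; ring
  · exact (convex_Ioi (0 : ℝ)) ((hf.2 u).1 h) ((hg.2 u).1 h) hα hβ hαβ
  · simp [(hf.2 u).2.1 h, (hg.2 u).2.1 h]
  · exact (convex_Iio (0 : ℝ)) ((hf.2 u).2.2 h) ((hg.2 u).2.2 h) hα hβ hαβ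

theorem exists_continuous_isAddSign {A T : Type*} [AddCommMonoid A] [TopologicalSpace T]
    [NormalSpace T] [ParacompactSpace T] {l : T → A → ℝ} (hl : ∀ t, IsArchSign (l t))
    (hc : ∀ v, Continuous fun t => l t v) (hneg : ∀ t, ∃ a, l t a < 0)
    (hpos : ∀ t, ∃ b, ∃ U ∈ 𝓝 t, (∀ s ∈ U, 0 < l s b) ∧
      ∀ u, ∃ K : ℕ, ∀ s ∈ U, 0 < l s (K • b + u)) :
    ∃ f : C(T, A → ℝ), ∀ t, IsAddSign (l t) (f t) := by
  refine exists_continuous_forall_mem_convex_of_local (fun t => IsAddSign.convex (l t))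
    fun t₀ => ?_
  obtain ⟨a, ha⟩ := hneg t₀
  obtain ⟨b, U, hU, hb, hK⟩ := hpos t₀
  set V := U ∩ {t | l t a < 0}
  have hex (t : T) : ∃ f, t ∈ V → IsAddSign (l t) f ∧ f a = -1 := by
    by_cases ht : t ∈ V
    · exact ((hl t).exists_isAddSign ht.2 (hb t ht.1)).imp fun f h _ => h
    · exact ⟨0, fun h => absurd h ht⟩
  choose f hf using hex
  refine ⟨V, inter_mem hU ((hc a).continuousAt.eventually_lt_const ha), f,
    continuousOn_pi.2 fun u => ?_, fun t ht => (hf t ht).1⟩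
  obtain ⟨K, hK⟩ := hK u
  have h1 := IsAddSign.continuousOn_of_pos hc (fun t ht => (hf t ht).1) (fun t ht => (hf t ht).2)
    (fun t ht => hK t ht.1)
  have h2 := IsAddSign.continuousOn_of_pos hc (fun t ht => (hf t ht).1) (fun t ht => (hf t ht).2)
    (fun t ht => hb t ht.1)
  refine (h1.sub (h2.const_smul (K : ℝ))).congr fun t ht => ?_
  have := (hf t ht).1.1 (K • b) u
  rw [(hf t ht).1.map_nsmul] at this
  change f t u = f t (K • b + u) - (K : ℝ) * f t b
  linarith

/-- A strictly internal, asymptotically idempotent mean on nonempty multisets. -/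
structure IsMultisetMean {X : Type*} (m : Multiset X → ℝ) : Prop where
  min_le : ∀ u v, u ≠ 0 → v ≠ 0 → min (m u) (m v) ≤ m (u + v)
  le_max : ∀ u v, u ≠ 0 → v ≠ 0 → m (u + v) ≤ max (m u) (m v)
  min_lt : ∀ u v, u ≠ 0 → v ≠ 0 → m u ≠ m v → min (m u) (m v) < m (u + v)
  lt_max : ∀ u v, u ≠ 0 → v ≠ 0 → m u ≠ m v → m (u + v) < max (m u) (m v)
  tendsto : ∀ u, u ≠ 0 → ∀ y, Tendsto (fun n : ℕ => m (n • u + {y})) atTop (𝓝 (m u))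

open Classical in
/-- The deviation of the mean `m` from `t`, which is `0` at the empty multiset. -/
noncomputable def meanDev {X : Type*} (m : Multiset X → ℝ) (t : ℝ) (u : Multiset X) : ℝ :=
  if u = 0 then 0 else m u - t

section meanDev

variable {X : Type*} {m : Multiset X → ℝ} {t : ℝ} {u : Multiset X}

theorem meanDev_zero : meanDev m t 0 = 0 := by simp [meanDev]

theorem meanDev_of_ne (hu : u ≠ 0) : meanDev m t u = m u - t := by simp [meanDev, hu]

theorem continuous_meanDev : Continuous fun t => meanDev m t u := by
  unfold meanDev
  split_ifs <;> fun_prop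

theorem ne_zero_of_meanDev_ne (h : meanDev m t u ≠ 0) : u ≠ 0 := by
  rintro rfl
  exact h meanDev_zero

theorem IsMultisetMean.isArchSign (hm : IsMultisetMean m) (t : ℝ) : IsArchSign (meanDev m t) where
  map_zero := meanDev_zero
  add_nonneg u v hu hv := by
    by_cases hu0 : u = 0
    · simpa [hu0] using hv
    by_cases hv0 : v = 0
    · simpa [hv0] using hu
    rw [meanDev_of_ne hu0] at hu
    rw [meanDev_of_ne hv0] at hv
    rw [meanDev_of_ne (by simp [hu0])]
    have := hm.min_le u v hu0 hv0
    rcases min_le_iff.1 this with h | h <;> linarith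
  add_nonpos u v hu hv := by
    by_cases hu0 : u = 0
    · simpa [hu0] using hv
    by_cases hv0 : v = 0
    · simpa [hv0] using hu
    rw [meanDev_of_ne hu0] at hu
    rw [meanDev_of_ne hv0] at hv
    rw [meanDev_of_ne (by simp [hu0])]
    have := hm.le_max u v hu0 hv0
    rcases le_max_iff.1 this with h | h <;> linarith
  add_pos u v hu hv := by
    have hu0 := ne_zero_of_meanDev_ne hu.ne'
    by_cases hv0 : v = 0
    · simpa [hv0] using hu
    rw [meanDev_of_ne hu0] at hu
    rw [meanDev_of_ne hv0] at hv
    rw [meanDev_of_ne (by simp [hu0])]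
    by_cases he : m u = m v
    · have := hm.min_le u v hu0 hv0
      rw [← he, min_self] at this
      linarith
    · rcases min_lt_iff.1 (hm.min_lt u v hu0 hv0 he) with h | h <;> linarith
  add_neg u v hu hv := by
    have hu0 := ne_zero_of_meanDev_ne hu.ne
    by_cases hv0 : v = 0
    · simpa [hv0] using hu
    rw [meanDev_of_ne hu0] at hu
    rw [meanDev_of_ne hv0] at hv
    rw [meanDev_of_ne (by simp [hu0])]
    by_cases he : m u = m v
    · have := hm.le_max u v hu0 hv0
      rw [← he, max_self] at this
      linarith
    · rcases lt_max_iff.1 (hm.lt_max u v hu0 hv0 he) with h | h <;> linarith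
  exists_pos u v hu := by
    have hu0 := ne_zero_of_meanDev_ne hu.ne'
    induction v using Multiset.induction_on with
    | empty => exact ⟨1, by simpa using hu⟩
    | cons y v ih =>
      obtain ⟨n, hn⟩ := ih
      obtain ⟨k, hk⟩ :=
        ((hm.tendsto u hu0 y).eventually_const_lt (sub_pos.1 (meanDev_of_ne hu0 ▸ hu))).exists
      have h1 : 0 < meanDev m t (k • u + {y}) := by
        rw [meanDev_of_ne (by simp)]
        linarith
      refine ⟨n + k, ?_⟩
      have h2 : (n + k) • u + y ::ₘ v = (n • u + v) + (k • u + {y}) := by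
        rw [add_smul, ← Multiset.singleton_add]
        abel
      rw [h2]
      by_cases h0 : n • u + v = 0
      · rwa [h0, zero_add]
      rw [meanDev_of_ne h0] at hn
      rw [meanDev_of_ne (by simp)] at h1 ⊢
      rcases min_le_iff.1 (hm.min_le _ (k • u + {y}) h0 (by simp)) with h | h <;> linarith
  exists_neg u v hu := by
    have hu0 := ne_zero_of_meanDev_ne hu.ne
    induction v using Multiset.induction_on with
    | empty => exact ⟨1, by simpa using hu⟩
    | cons y v ih =>
      obtain ⟨n, hn⟩ := ih
      obtain ⟨k, hk⟩ :=
        ((hm.tendsto u hu0 y).eventually_lt_const (sub_neg.1 (meanDev_of_ne hu0 ▸ hu))).exists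
      have h1 : meanDev m t (k • u + {y}) < 0 := by
        rw [meanDev_of_ne (by simp)]
        linarith
      refine ⟨n + k, ?_⟩
      have h2 : (n + k) • u + y ::ₘ v = (n • u + v) + (k • u + {y}) := by
        rw [add_smul, ← Multiset.singleton_add]
        abel
      rw [h2]
      by_cases h0 : n • u + v = 0
      · rwa [h0, zero_add]
      rw [meanDev_of_ne h0] at hn
      rw [meanDev_of_ne (by simp)] at h1 ⊢
      rcases le_max_iff.1 (hm.le_max _ (k • u + {y}) h0 (by simp)) with h | h <;> linarith

end meanDev

theorem sum_append {X G : Type*} [AddCommMonoid G] (g : X → G) {n k : ℕ} (x : Fin n → X)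
    (y : Fin k → X) :
    ∑ i, g (Fin.append x y i) = ∑ i, g (x i) + ∑ i, g (y i) := by
  simp [Fin.sum_univ_add]

theorem sum_repBlock {X G : Type*} [AddCommMonoid G] (g : X → G) {k : ℕ} (n : ℕ)
    (x : Fin k → X) : ∑ i, g (repBlock n x i) = n • ∑ i, g (x i) := by
  rw [← finProdFinEquiv.sum_comp, Fintype.sum_prod_type, Finset.smul_sum]
  refine Finset.sum_congr rfl fun i _ => ?_
  have h (j : Fin n) : repBlock n x (finProdFinEquiv (i, j)) = x i := by
    unfold repBlock
    congr 1
    ext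
    have hn : 0 < n := j.pos
    simp [Nat.add_mul_div_left _ _ hn, Nat.div_eq_of_lt j.isLt]
  simp [h]

theorem exists_perm_of_sum_singleton_eq {X : Type*} {n : ℕ} {x y : Fin n → X}
    (h : ∑ i, ({x i} : Multiset X) = ∑ i, {y i}) : ∃ π : Equiv.Perm (Fin n), x ∘ π = y := by
  classical
  have hcard (c : X) : Fintype.card {i // y i = c} = Fintype.card {i // x i = c} := by
    have := congrArg (Multiset.count c) h
    simp only [Multiset.count_sum', Multiset.count_singleton, Finset.sum_boole, Nat.cast_id] at this
    rw [Fintype.card_subtype, Fintype.card_subtype]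
    simpa only [eq_comm] using this.symm
  exact ⟨Equiv.ofFiberEquiv fun c => Fintype.equivOfCardEq (hcard c),
    funext fun i => Equiv.ofFiberEquiv_map _ i⟩

theorem exists_sum_singleton_eq {X : Type*} (s : Multiset X) :
    ∃ x : Fin s.card → X, ∑ i, {x i} = s := by
  induction s using Quotient.inductionOn with
  | h L =>
    refine ⟨L.get, ?_⟩
    have h := Multiset.sum_map_singleton (L : Multiset X)
    rw [Multiset.map_coe, Multiset.sum_coe, ← Fin.sum_univ_fun_getElem] at h
    exact h

theorem exists_multiset_extension {X : Type*} (M : ∀ n : ℕ, (Fin n → X) → ℝ)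
    (hM : ∀ n : ℕ, 0 < n → ∀ (x : Fin n → X) (π : Equiv.Perm (Fin n)), M n (x ∘ π) = M n x) :
    ∃ m : Multiset X → ℝ, ∀ n : ℕ, 0 < n → ∀ x : Fin n → X, M n x = m (∑ i, {x i}) := by
  choose r hr using exists_sum_singleton_eq (X := X)
  refine ⟨fun s => M s.card (r s), fun n hn x => ?_⟩
  have key (s : Multiset X) (hs : ∑ i, {x i} = s) : M n x = M s.card (r s) := by
    have hcard : s.card = n := by simp [← hs]
    have hs' := hr s
    generalize r s = y at hs'
    revert y
    rw [hcard]
    intro y hy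
    obtain ⟨π, rfl⟩ := exists_perm_of_sum_singleton_eq (hs.trans hy.symm)
    exact (hM n hn x π).symm
  exact key _ rfl

theorem exists_mem_between_left {Θ : Set ℝ} (hΘ : IsOpen Θ) {a c : ℝ} (ha : a ∈ Θ) (hc : c < a) :
    ∃ t ∈ Θ, c < t ∧ t < a := by
  obtain ⟨l, u, ⟨hl, hu⟩, hsub⟩ := mem_nhds_iff_exists_Ioo_subset.1 (hΘ.mem_nhds ha)
  obtain ⟨t, ht1, ht2⟩ := exists_between (max_lt hl hc)
  exact ⟨t, hsub ⟨(le_max_left _ _).trans_lt ht1, ht2.trans hu⟩,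
    (le_max_right _ _).trans_lt ht1, ht2⟩

theorem exists_mem_between_right {Θ : Set ℝ} (hΘ : IsOpen Θ) {a c : ℝ} (ha : a ∈ Θ) (hc : a < c) :
    ∃ t ∈ Θ, a < t ∧ t < c := by
  obtain ⟨l, u, ⟨hl, hu⟩, hsub⟩ := mem_nhds_iff_exists_Ioo_subset.1 (hΘ.mem_nhds ha)
  obtain ⟨t, ht1, ht2⟩ := exists_between (lt_min hu hc)
  exact ⟨t, hsub ⟨hl.trans ht1, ht2.trans_le (min_le_left _ _)⟩,
    ht1, ht2.trans_le (min_le_right _ _)⟩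

section ZEstimator

variable {X : Type*} {Θ : Set ℝ} {M : ∀ n : ℕ, (Fin n → X) → ℝ} {ψ : X → ℝ → ℝ}

theorem lt_of_sum_pos (hest : ∀ n : ℕ, 0 < n → IsThetaEst Θ ψ n (M n))
    (hzero : ∀ n : ℕ, 0 < n → ∀ x : Fin n → X, ∑ i, ψ (x i) (M n x) = 0) {n : ℕ} (hn : 0 < n)
    {x : Fin n → X} {t : ℝ} (ht : t ∈ Θ) (h : 0 < ∑ i, ψ (x i) t) : t < M n x := by
  by_contra! hle
  rcases hle.lt_or_eq with hlt | rfl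
  · exact h.not_gt ((hest n hn x).2.2 t ht hlt)
  · exact h.ne' (hzero n hn x)

theorem lt_of_sum_neg (hest : ∀ n : ℕ, 0 < n → IsThetaEst Θ ψ n (M n))
    (hzero : ∀ n : ℕ, 0 < n → ∀ x : Fin n → X, ∑ i, ψ (x i) (M n x) = 0) {n : ℕ} (hn : 0 < n)
    {x : Fin n → X} {t : ℝ} (ht : t ∈ Θ) (h : ∑ i, ψ (x i) t < 0) : M n x < t := by
  by_contra! hle
  rcases hle.lt_or_eq with hlt | rfl
  · exact h.not_gt ((hest n hn x).2.1 t ht hlt)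
  · exact h.ne (hzero n hn x)

theorem eq_of_sum_eq_zero (hest : ∀ n : ℕ, 0 < n → IsThetaEst Θ ψ n (M n)) {n : ℕ} (hn : 0 < n)
    {x : Fin n → X} {t : ℝ} (ht : t ∈ Θ) (h : ∑ i, ψ (x i) t = 0) : M n x = t := by
  rcases lt_trichotomy (M n x) t with hlt | heq | hlt
  · exact absurd h ((hest n hn x).2.2 t ht hlt).ne
  · exact heq
  · exact absurd h ((hest n hn x).2.1 t ht hlt).ne'

theorem strictly_internal_of_isThetaEst (hest : ∀ n : ℕ, 0 < n → IsThetaEst Θ ψ n (M n))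
    (hzero : ∀ n : ℕ, 0 < n → ∀ x : Fin n → X, ∑ i, ψ (x i) (M n x) = 0) {n k : ℕ} (hn : 0 < n)
    (hk : 0 < k) (x : Fin n → X) (y : Fin k → X) :
    (min (M n x) (M k y) ≤ M (n + k) (Fin.append x y) ∧
        M (n + k) (Fin.append x y) ≤ max (M n x) (M k y)) ∧
      (M n x ≠ M k y →
        min (M n x) (M k y) < M (n + k) (Fin.append x y) ∧
        M (n + k) (Fin.append x y) < max (M n x) (M k y)) := by
  have hnk : 0 < n + k := Nat.add_pos_left hn k
  have hx := hest n hn x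
  have hy := hest k hk y
  have hx0 := hzero n hn x
  have hy0 := hzero k hk y
  have hsum (t : ℝ) : ∑ i, ψ (Fin.append x y i) t = ∑ i, ψ (x i) t + ∑ i, ψ (y i) t :=
    sum_append (fun z => ψ z t) x y
  rcases lt_trichotomy (M n x) (M k y) with h | h | h
  · have h1 : M n x < M (n + k) (Fin.append x y) := lt_of_sum_pos hest hzero hnk hx.1 (by
      rw [hsum, hx0, zero_add]; exact hy.2.1 _ hx.1 h)
    have h2 : M (n + k) (Fin.append x y) < M k y := lt_of_sum_neg hest hzero hnk hy.1 (by
      rw [hsum, hy0, add_zero]; exact hx.2.2 _ hy.1 h)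
    rw [min_eq_left h.le, max_eq_right h.le]
    exact ⟨⟨h1.le, h2.le⟩, fun _ => ⟨h1, h2⟩⟩
  · have h1 : M (n + k) (Fin.append x y) = M k y := eq_of_sum_eq_zero hest hnk hy.1 (by
      rw [hsum, hy0, ← h, hx0, add_zero])
    simp [h1, h]
  · have h1 : M k y < M (n + k) (Fin.append x y) := lt_of_sum_pos hest hzero hnk hy.1 (by
      rw [hsum, hy0, add_zero]; exact hx.2.1 _ hy.1 h)
    have h2 : M (n + k) (Fin.append x y) < M n x := lt_of_sum_neg hest hzero hnk hx.1 (by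
      rw [hsum, hx0, zero_add]; exact hy.2.2 _ hx.1 h)
    rw [min_eq_right h.le, max_eq_left h.le]
    exact ⟨⟨h1.le, h2.le⟩, fun _ => ⟨h1, h2⟩⟩

theorem tendsto_of_isThetaEst (hΘo : IsOpen Θ) (hest : ∀ n : ℕ, 0 < n → IsThetaEst Θ ψ n (M n))
    (hzero : ∀ n : ℕ, 0 < n → ∀ x : Fin n → X, ∑ i, ψ (x i) (M n x) = 0) {k : ℕ} (hk : 0 < k)
    (x : Fin k → X) (y : X) :
    Tendsto (fun n : ℕ => M (k * n + 1) (Fin.append (repBlock n x) (fun _ : Fin 1 => y)))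
      atTop (𝓝 (M k x)) := by
  have hx := hest k hk x
  have hsum (n : ℕ) (t : ℝ) :
      ∑ i, ψ (Fin.append (repBlock n x) (fun _ : Fin 1 => y) i) t
        = n * ∑ i, ψ (x i) t + ψ y t := by
    rw [sum_append (fun z => ψ z t), sum_repBlock (fun z => ψ z t)]
    simp
  refine tendsto_order.2 ⟨fun c hc => ?_, fun c hc => ?_⟩
  · obtain ⟨t, ht, hct, htx⟩ := exists_mem_between_left hΘo hx.1 hc
    have hlim := tendsto_atTop_add_const_right atTop (ψ y t)
      (tendsto_natCast_atTop_atTop.atTop_mul_const (hx.2.1 t ht htx))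
    filter_upwards [hlim.eventually_gt_atTop 0] with n hn
    exact hct.trans (lt_of_sum_pos hest hzero (Nat.succ_pos _) ht (by rwa [hsum]))
  · obtain ⟨t, ht, htx, hct⟩ := exists_mem_between_right hΘo hx.1 hc
    have hlim := tendsto_atBot_add_const_right atTop (ψ y t)
      (tendsto_natCast_atTop_atTop.atTop_mul_const_of_neg (hx.2.2 t ht htx))
    filter_upwards [hlim.eventually_lt_atBot 0] with n hn
    exact (lt_of_sum_neg hest hzero (Nat.succ_pos _) ht (by rwa [hsum])).trans hct

end ZEstimator

theorem exists_lt_of_sInf_eq {ι : Type*} {Θ : Set ℝ} (hΘo : IsOpen Θ) {g : ι → ℝ}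
    (h : sInf (Set.range fun i => (g i : EReal)) = sInf (Real.toEReal '' Θ)) {t : ℝ}
    (ht : t ∈ Θ) : ∃ i, g i < t := by
  obtain ⟨s, hs, -, hst⟩ := exists_mem_between_left hΘo ht (sub_one_lt t)
  have hlt : sInf (Set.range fun i => (g i : EReal)) < t :=
    h.trans_lt ((sInf_le (Set.mem_image_of_mem _ hs)).trans_lt (EReal.coe_lt_coe_iff.2 hst))
  obtain ⟨_, ⟨i, rfl⟩, hi⟩ := sInf_lt_iff.1 hlt
  exact ⟨i, EReal.coe_lt_coe_iff.1 hi⟩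

theorem exists_gt_of_sSup_eq {ι : Type*} {Θ : Set ℝ} (hΘo : IsOpen Θ) {g : ι → ℝ}
    (h : sSup (Set.range fun i => (g i : EReal)) = sSup (Real.toEReal '' Θ)) {t : ℝ}
    (ht : t ∈ Θ) : ∃ i, t < g i := by
  obtain ⟨s, hs, hst, -⟩ := exists_mem_between_right hΘo ht (lt_add_one t)
  have hlt : (t : EReal) < sSup (Set.range fun i => (g i : EReal)) :=
    ((EReal.coe_lt_coe_iff.2 hst).trans_le (le_sSup (Set.mem_image_of_mem _ hs))).trans_eq h.symm
  obtain ⟨_, ⟨i, rfl⟩, hi⟩ := lt_sSup_iff.1 hlt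
  exact ⟨i, EReal.coe_lt_coe_iff.1 hi⟩

theorem IsMultisetMean.exists_continuous_isAddSign {X : Type*} {m : Multiset X → ℝ}
    (hm : IsMultisetMean m) {Θ : Set ℝ} (hneg : ∀ t ∈ Θ, ∃ x, m {x} < t)
    (hpos : ∀ t ∈ Θ, ∃ x, t < m {x}) :
    ∃ f : C(Θ, Multiset X → ℝ), ∀ t : Θ, IsAddSign (meanDev m (t : ℝ)) (f t) := by
  refine _root_.exists_continuous_isAddSign (fun t => hm.isArchSign (t : ℝ))
    (fun v => continuous_meanDev.comp continuous_subtype_val) (fun t => ?_) (fun t => ?_)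
  · obtain ⟨x, hx⟩ := hneg t t.2
    exact ⟨{x}, by rw [meanDev_of_ne (by simp)]; linarith⟩
  · obtain ⟨x, hx⟩ := hpos t t.2
    obtain ⟨t₁, h1, h2⟩ := exists_between hx
    refine ⟨{x}, {s : Θ | (s : ℝ) < t₁},
      (isOpen_Iio.preimage continuous_subtype_val).mem_nhds h1, fun s hs => ?_, fun u => ?_⟩
    · rw [meanDev_of_ne (by simp)]
      exact sub_pos.2 (lt_trans hs h2)
    · obtain ⟨K, hK⟩ := (hm.isArchSign t₁).exists_pos {x} u
        (by rw [meanDev_of_ne (by simp)]; linarith)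
      refine ⟨K, fun s hs => ?_⟩
      have hne := ne_zero_of_meanDev_ne hK.ne'
      rw [meanDev_of_ne hne] at hK ⊢
      have : (s : ℝ) < t₁ := hs
      linarith

theorem IsAddSign.map_sum_singleton {X : Type*} {l f : Multiset X → ℝ} (hf : IsAddSign l f)
    {n : ℕ} (x : Fin n → X) : f (∑ i, {x i}) = ∑ i, f {x i} :=
  map_sum (⟨⟨f, hf.map_zero⟩, hf.1⟩ : Multiset X →+ ℝ) _ _

theorem sum_singleton_ne_zero {X : Type*} {n : ℕ} (hn : 0 < n) (x : Fin n → X) :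
    ∑ i, ({x i} : Multiset X) ≠ 0 := by
  intro h
  have := congrArg Multiset.card h
  simp at this
  omega

theorem isMultisetMean_of_extension {X : Type*} {M : ∀ n : ℕ, (Fin n → X) → ℝ}
    {m : Multiset X → ℝ} (hm : ∀ n : ℕ, 0 < n → ∀ x : Fin n → X, M n x = m (∑ i, {x i}))
    (hinternal : ∀ n k : ℕ, 0 < n → 0 < k → ∀ (x : Fin n → X) (y : Fin k → X),
      (min (M n x) (M k y) ≤ M (n + k) (Fin.append x y) ∧
        M (n + k) (Fin.append x y) ≤ max (M n x) (M k y)) ∧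
      (M n x ≠ M k y →
        min (M n x) (M k y) < M (n + k) (Fin.append x y) ∧
        M (n + k) (Fin.append x y) < max (M n x) (M k y)))
    (hlim : ∀ k : ℕ, 0 < k → ∀ (x : Fin k → X) (y : X),
      Tendsto (fun n : ℕ => M (k * n + 1) (Fin.append (repBlock n x) (fun _ : Fin 1 => y)))
        atTop (𝓝 (M k x))) : IsMultisetMean m := by
  have key (u v : Multiset X) (hu : u ≠ 0) (hv : v ≠ 0) :
      (min (m u) (m v) ≤ m (u + v) ∧ m (u + v) ≤ max (m u) (m v)) ∧
      (m u ≠ m v → min (m u) (m v) < m (u + v) ∧ m (u + v) < max (m u) (m v)) := by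
    obtain ⟨x, hx⟩ := exists_sum_singleton_eq u
    obtain ⟨y, hy⟩ := exists_sum_singleton_eq v
    have hu' := Multiset.card_pos.2 hu
    have hv' := Multiset.card_pos.2 hv
    have := hinternal _ _ hu' hv' x y
    rwa [hm _ hu' x, hm _ hv' y, hm _ (Nat.add_pos_left hu' _),
      sum_append (fun z => ({z} : Multiset X)), hx, hy] at this
  refine ⟨fun u v hu hv => (key u v hu hv).1.1, fun u v hu hv => (key u v hu hv).1.2,
    fun u v hu hv h => ((key u v hu hv).2 h).1, fun u v hu hv h => ((key u v hu hv).2 h).2,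
    fun u hu y => ?_⟩
  obtain ⟨x, hx⟩ := exists_sum_singleton_eq u
  have hu' := Multiset.card_pos.2 hu
  have := hlim _ hu' x y
  rw [hm _ hu' x, hx] at this
  refine this.congr fun n => ?_
  rw [hm (u.card * n + 1) (Nat.succ_pos _), sum_append (fun z => ({z} : Multiset X)),
    sum_repBlock (fun z => ({z} : Multiset X)), hx]
  simp

/-- Axiomatic characterisation of (usual) ψ-estimators (Z-estimators)
(Barczy–Pálés, `Thm_charac_cont_psi_est`). -/
theorem charac_Z_estimators
    {X : Type*} [Nonempty X] (Θ : Set ℝ)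
    (hΘo : IsOpen Θ) (hΘc : Θ.OrdConnected) (hΘnd : ∃ s ∈ Θ, ∃ t ∈ Θ, s < t)
    (M : ∀ n : ℕ, (Fin n → X) → ℝ)
    (hMΘ : ∀ n : ℕ, 0 < n → ∀ x : Fin n → X, M n x ∈ Θ)
    (hinf : sInf (Set.range fun x : X => (M 1 (fun _ => x) : EReal))
        = sInf (Real.toEReal '' Θ))
    (hsup : sSup (Set.range fun x : X => (M 1 (fun _ => x) : EReal))
        = sSup (Real.toEReal '' Θ)) :
    (∃ ψ : X → ℝ → ℝ, PsiClass Θ ψ ∧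
        (∀ x : X, ContinuousOn (ψ x) Θ) ∧
        (∀ n : ℕ, 0 < n → IsThetaEst Θ ψ n (M n)) ∧
        (∀ n : ℕ, 0 < n → ∀ x : Fin n → X, ∑ i, ψ (x i) (M n x) = 0)) ↔
      ((∀ n : ℕ, 0 < n → ∀ (x : Fin n → X) (π : Equiv.Perm (Fin n)),
          M n (x ∘ π) = M n x) ∧
       (∀ n k : ℕ, 0 < n → 0 < k → ∀ (x : Fin n → X) (y : Fin k → X),
          (min (M n x) (M k y) ≤ M (n + k) (Fin.append x y) ∧
            M (n + k) (Fin.append x y) ≤ max (M n x) (M k y)) ∧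
          (M n x ≠ M k y →
            min (M n x) (M k y) < M (n + k) (Fin.append x y) ∧
            M (n + k) (Fin.append x y) < max (M n x) (M k y))) ∧
       (∀ k : ℕ, 0 < k → ∀ (x : Fin k → X) (y : X),
          Tendsto (fun n : ℕ =>
              M (k * n + 1) (Fin.append (repBlock n x) (fun _ : Fin 1 => y)))
            atTop (𝓝 (M k x)))) := by
  constructor
  · rintro ⟨ψ, -, -, hest, hzero⟩
    refine ⟨fun n hn x π => ?_, fun n k hn hk x y =>
      strictly_internal_of_isThetaEst hest hzero hn hk x y,
      fun k hk x y => tendsto_of_isThetaEst hΘo hest hzero hk x y⟩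
    refine eq_of_sum_eq_zero hest hn (hMΘ n hn x) ?_
    rw [← hzero n hn x]
    exact Equiv.sum_comp π fun i => ψ (x i) (M n x)
  · rintro ⟨hsymm, hinternal, hlim⟩
    obtain ⟨m, hm⟩ := exists_multiset_extension M hsymm
    have hmean := isMultisetMean_of_extension hm hinternal hlim
    have hm1 (x : X) : m {x} = M 1 fun _ => x := by simp [hm 1 one_pos]
    obtain ⟨f, hf⟩ := hmean.exists_continuous_isAddSign (Θ := Θ)
      (fun t ht => by simpa only [hm1] using exists_lt_of_sInf_eq hΘo hinf ht)
      (fun t ht => by simpa only [hm1] using exists_gt_of_sSup_eq hΘo hsup ht)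
    classical
    let ψ : X → ℝ → ℝ := fun x t => if ht : t ∈ Θ then f ⟨t, ht⟩ {x} else 0
    have hψ {t : ℝ} (ht : t ∈ Θ) (x : X) : ψ x t = f ⟨t, ht⟩ {x} := dif_pos ht
    have hsum {t : ℝ} (ht : t ∈ Θ) {n : ℕ} (x : Fin n → X) :
        ∑ i, ψ (x i) t = f ⟨t, ht⟩ (∑ i, {x i}) := by
      rw [(hf _).map_sum_singleton]
      exact Finset.sum_congr rfl fun i _ => hψ ht (x i)
    have hdev (t : ℝ) {n : ℕ} (hn : 0 < n) (x : Fin n → X) :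
        meanDev m t (∑ i, {x i}) = M n x - t := by
      rw [meanDev_of_ne (sum_singleton_ne_zero hn x), hm n hn]
    have hest (n : ℕ) (hn : 0 < n) : IsThetaEst Θ ψ n (M n) := by
      refine fun x => ⟨hMΘ n hn x, fun t ht hlt => ?_, fun t ht hlt => ?_⟩
      · rw [hsum ht]
        exact ((hf ⟨t, ht⟩).2 _).1 (by rw [hdev t hn]; linarith)
      · rw [hsum ht]
        exact ((hf ⟨t, ht⟩).2 _).2.2 (by rw [hdev t hn]; linarith)
    refine ⟨ψ, fun x => ?_, fun x => ?_, hest, fun n hn x => ?_⟩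
    · obtain ⟨hM, hleft, hright⟩ := hest 1 one_pos fun _ => x
      obtain ⟨s, hs, -, hs'⟩ := exists_mem_between_left hΘo hM (sub_one_lt _)
      obtain ⟨t, ht, ht', -⟩ := exists_mem_between_right hΘo hM (lt_add_one _)
      exact ⟨s, hs, t, ht, hs'.trans ht', by simpa using hleft s hs hs',
        by simpa using hright t ht ht'⟩
    · rw [continuousOn_iff_continuous_domRestrict]
      exact ((continuous_apply ({x} : Multiset X)).comp f.continuous).congr fun t =>
        (hψ t.2 x).symm
    · have ht := hMΘ n hn x
      rw [hsum ht]
      exact ((hf ⟨_, ht⟩).2 _).2.1 (by rw [hdev _ hn]; exact sub_self _)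
end

section
/- Let I be a compact nondegenerate interval of ℝ and let M_n : Iⁿ → ℝ, n ∈ ℕ, be a sequence of functions. Then the following are equivalent: (i) there exists a continuous and strictly monotone function f : I → ℝ such that M_n(x₁,…,xₙ) = f⁻¹((1/n) Σᵢ₌₁ⁿ f(xᵢ)) for all x₁,…,xₙ ∈ I and n ∈ ℕ; (ii) for each n ∈ ℕ, M_n is continuous and strictly increasing in each variable; M_n is symmetric (invariant under permutations of its arguments); M_n(x,…,x) = x for all x ∈ I; and M_{n+m}(x₁,…,xₙ,y₁,…,y_m) = M_{n+m}(x̄ₙ,…,x̄ₙ,y₁,…,y_m) for all n,m ∈ ℕ and x₁,…,xₙ,y₁,…,y_m ∈ I, where x̄ₙ := M_n(x₁,…,xₙ) is repeated n times. -/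
open Set

/-- A symmetric mean on `[a, b]`, presented as a function `m` of finite multisets, which is
continuous and strictly increasing in each entry and reflexive. -/
structure IsStrictMean (a b : ℝ) (m : Multiset ℝ → ℝ) : Prop where
  continuousOn_cons : ∀ s : Multiset ℝ, (∀ x ∈ s, x ∈ Icc a b) →
    ContinuousOn (fun t => m (t ::ₘ s)) (Icc a b)
  strictMonoOn_cons : ∀ s : Multiset ℝ, (∀ x ∈ s, x ∈ Icc a b) →
    StrictMonoOn (fun t => m (t ::ₘ s)) (Icc a b)
  replicate : ∀ n : ℕ, n ≠ 0 → ∀ t ∈ Icc a b, m (Multiset.replicate n t) = t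

/-- A symmetric strict mean for which the entries of any part of a multiset may be replaced by
the mean of that part. -/
structure IsAssociativeMean (a b : ℝ) (m : Multiset ℝ → ℝ) : Prop extends IsStrictMean a b m where
  assoc : ∀ s t : Multiset ℝ, s ≠ 0 → (∀ x ∈ s, x ∈ Icc a b) → (∀ x ∈ t, x ∈ Icc a b) →
    m (s + t) = m (Multiset.replicate s.card (m s) + t)

/-- Two multisets in `[a, b]` of the same size are interchangeable for `m` if replacing one by
the other as a part of any multiset in `[a, b]` does not change the mean. -/
structure Interchangeable (a b : ℝ) (m : Multiset ℝ → ℝ) (u v : Multiset ℝ) : Prop where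
  left_mem : ∀ x ∈ u, x ∈ Icc a b
  right_mem : ∀ x ∈ v, x ∈ Icc a b
  card_eq : u.card = v.card
  mean_add : ∀ t : Multiset ℝ, (∀ x ∈ t, x ∈ Icc a b) → m (u + t) = m (v + t)

namespace Interchangeable

variable {a b : ℝ} {m : Multiset ℝ → ℝ} {u v w z : Multiset ℝ}

theorem refl (hu : ∀ x ∈ u, x ∈ Icc a b) : Interchangeable a b m u u :=
  ⟨hu, hu, rfl, fun _ _ => rfl⟩

theorem symm (h : Interchangeable a b m u v) : Interchangeable a b m v u :=
  ⟨h.right_mem, h.left_mem, h.card_eq.symm, fun t ht => (h.mean_add t ht).symm⟩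

theorem trans (h : Interchangeable a b m u v) (h' : Interchangeable a b m v w) :
    Interchangeable a b m u w :=
  ⟨h.left_mem, h'.right_mem, h.card_eq.trans h'.card_eq,
    fun t ht => (h.mean_add t ht).trans (h'.mean_add t ht)⟩

theorem mem_add (hu : ∀ x ∈ u, x ∈ Icc a b) (hv : ∀ x ∈ v, x ∈ Icc a b) :
    ∀ x ∈ u + v, x ∈ Icc a b := fun x hx =>
  (Multiset.mem_add.1 hx).elim (hu x) (hv x)

theorem add (h : Interchangeable a b m u v) (h' : Interchangeable a b m w z) :
    Interchangeable a b m (u + w) (v + z) where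
  left_mem := mem_add h.left_mem h'.left_mem
  right_mem := mem_add h.right_mem h'.right_mem
  card_eq := by simp [h.card_eq, h'.card_eq]
  mean_add t ht := by
    rw [add_assoc, h.mean_add _ (mem_add h'.left_mem ht), add_left_comm,
      h'.mean_add _ (mem_add h.right_mem ht), add_left_comm, add_assoc]

theorem nsmul (h : Interchangeable a b m u v) (n : ℕ) :
    Interchangeable a b m (n • u) (n • v) := by
  induction n with
  | zero => simpa using refl (by simp)
  | succ n ih => simpa only [succ_nsmul] using ih.add h

theorem mean_eq (h : Interchangeable a b m u v) : m u = m v := by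
  simpa using h.mean_add 0 (by simp)

end Interchangeable

namespace IsStrictMean

variable {a b : ℝ} {m : Multiset ℝ → ℝ}

theorem le_replicate (h : IsStrictMean a b m) (hab : a ≤ b) (s t : Multiset ℝ)
    (hs : ∀ x ∈ s, x ∈ Icc a b) (ht : ∀ x ∈ t, x ∈ Icc a b) :
    m (s + t) ≤ m (Multiset.replicate s.card b + t) := by
  induction s using Multiset.induction generalizing t with
  | empty => simp
  | cons x s ih =>
    have hs' : ∀ y ∈ s, y ∈ Icc a b := fun y hy => hs y (Multiset.mem_cons_of_mem hy)
    have hx := hs x (Multiset.mem_cons_self x s)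
    have hb : b ∈ Icc a b := right_mem_Icc.2 hab
    have h1 := (h.strictMonoOn_cons (s + t)
      (Interchangeable.mem_add hs' ht)).monotoneOn hx hb hx.2
    have h2 := ih (b ::ₘ t) hs' (by
      intro y hy
      rcases Multiset.mem_cons.1 hy with rfl | hy
      exacts [hb, ht y hy])
    simp only [Multiset.card_cons, Multiset.replicate_succ, Multiset.cons_add,
      Multiset.add_cons] at h1 h2 ⊢
    exact h1.trans h2

theorem replicate_le (h : IsStrictMean a b m) (hab : a ≤ b) (s t : Multiset ℝ)
    (hs : ∀ x ∈ s, x ∈ Icc a b) (ht : ∀ x ∈ t, x ∈ Icc a b) :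
    m (Multiset.replicate s.card a + t) ≤ m (s + t) := by
  induction s using Multiset.induction generalizing t with
  | empty => simp
  | cons x s ih =>
    have hs' : ∀ y ∈ s, y ∈ Icc a b := fun y hy => hs y (Multiset.mem_cons_of_mem hy)
    have hx := hs x (Multiset.mem_cons_self x s)
    have ha : a ∈ Icc a b := left_mem_Icc.2 hab
    have h1 := (h.strictMonoOn_cons (s + t)
      (Interchangeable.mem_add hs' ht)).monotoneOn ha hx hx.1
    have h2 := ih (a ::ₘ t) hs' (by
      intro y hy
      rcases Multiset.mem_cons.1 hy with rfl | hy
      exacts [ha, ht y hy])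
    simp only [Multiset.card_cons, Multiset.replicate_succ, Multiset.cons_add,
      Multiset.add_cons] at h1 h2 ⊢
    exact h2.trans h1

theorem mem_Icc (h : IsStrictMean a b m) (hab : a ≤ b) {s : Multiset ℝ} (hs0 : s ≠ 0)
    (hs : ∀ x ∈ s, x ∈ Icc a b) : m s ∈ Icc a b := by
  have hc : s.card ≠ 0 := by simpa using hs0
  have h1 := h.le_replicate hab s 0 hs (by simp)
  have h2 := h.replicate_le hab s 0 hs (by simp)
  rw [add_zero, add_zero, h.replicate _ hc _ (right_mem_Icc.2 hab)] at h1
  rw [add_zero, add_zero, h.replicate _ hc _ (left_mem_Icc.2 hab)] at h2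
  exact ⟨h2, h1⟩

end IsStrictMean

namespace IsAssociativeMean

variable {a b : ℝ} {m : Multiset ℝ → ℝ}

theorem interchangeable_replicate (h : IsAssociativeMean a b m) (hab : a ≤ b) {s : Multiset ℝ}
    (hs0 : s ≠ 0) (hs : ∀ x ∈ s, x ∈ Icc a b) :
    Interchangeable a b m s (Multiset.replicate s.card (m s)) where
  left_mem := hs
  right_mem x hx := by
    rw [Multiset.eq_of_mem_replicate hx]
    exact h.mem_Icc hab hs0 hs
  card_eq := by simp
  mean_add t ht := h.assoc s t hs0 hs ht

theorem mean_nsmul (h : IsAssociativeMean a b m) (hab : a ≤ b) {s : Multiset ℝ}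
    (hs0 : s ≠ 0) (hs : ∀ x ∈ s, x ∈ Icc a b) {n : ℕ} (hn : n ≠ 0) : m (n • s) = m s := by
  rw [((h.interchangeable_replicate hab hs0 hs).nsmul n).mean_eq, Multiset.nsmul_replicate,
    h.replicate _ _ _ (h.mem_Icc hab hs0 hs)]
  simpa [hn] using hs0

/-- The multiset consisting of `p` copies of `b` and `q` copies of `a`. -/
def endpoints (a b : ℝ) (p q : ℕ) : Multiset ℝ :=
  Multiset.replicate p b + Multiset.replicate q a

theorem endpoints_mem (hab : a ≤ b) (p q : ℕ) : ∀ x ∈ endpoints a b p q, x ∈ Icc a b := by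
  apply Interchangeable.mem_add <;> intro x hx <;> rw [Multiset.eq_of_mem_replicate hx]
  exacts [right_mem_Icc.2 hab, left_mem_Icc.2 hab]

theorem card_endpoints (p q : ℕ) : (endpoints a b p q).card = p + q := by
  simp [endpoints]

theorem endpoints_ne_zero {p q : ℕ} (h : 0 < p + q) : endpoints a b p q ≠ 0 := by
  rw [← Multiset.card_pos, card_endpoints]
  exact h

theorem nsmul_endpoints (n p q : ℕ) : n • endpoints a b p q = endpoints a b (n * p) (n * q) := by
  simp [endpoints, Multiset.nsmul_replicate]

theorem endpoints_add (p q p' q' : ℕ) :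
    endpoints a b p q + endpoints a b p' q' = endpoints a b (p + p') (q + q') := by
  simp only [endpoints, Multiset.replicate_add]
  abel

theorem mean_endpoints_lt (h : IsAssociativeMean a b m) (hab : a < b) (p q d : ℕ) :
    m (endpoints a b p (q + (d + 1))) < m (endpoints a b (p + (d + 1)) q) := by
  have step (p q : ℕ) : m (endpoints a b p (q + 1)) < m (endpoints a b (p + 1) q) := by
    have := h.strictMonoOn_cons _ (endpoints_mem hab.le p q) (left_mem_Icc.2 hab.le)
      (right_mem_Icc.2 hab.le) hab
    simpa [endpoints, Multiset.replicate_succ] using this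
  induction d generalizing p q with
  | zero => exact step p q
  | succ d ih =>
    have h1 := step p (q + (d + 1))
    have h2 := ih (p + 1) q
    rw [show p + 1 + (d + 1) = p + (d + 1 + 1) by ring] at h2
    exact h1.trans h2

theorem mean_endpoints_lt_of_lt (h : IsAssociativeMean a b m) (hab : a < b) {p q p' q' : ℕ}
    (hlt : p * (p' + q') < p' * (p + q)) :
    m (endpoints a b p q) < m (endpoints a b p' q') := by
  have hn : 0 < p + q := Nat.pos_of_ne_zero fun h0 => by simp [h0] at hlt
  rcases Nat.eq_zero_or_pos (p' + q') with h0 | hn'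
  · have : p' = 0 := by omega
    simp [this] at hlt
  rw [← h.mean_nsmul hab.le (endpoints_ne_zero hn) (endpoints_mem hab.le p q) hn'.ne',
    ← h.mean_nsmul hab.le (endpoints_ne_zero hn') (endpoints_mem hab.le p' q') hn.ne',
    nsmul_endpoints, nsmul_endpoints]
  obtain ⟨d, hd⟩ := Nat.exists_eq_add_of_lt hlt
  have h1 : (p + q) * p' = (p' + q') * p + (d + 1) := by linarith
  have h2 : (p' + q') * q = (p + q) * q' + (d + 1) := by nlinarith
  rw [h1, h2]
  exact h.mean_endpoints_lt hab _ _ _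

/-- The supremum of the proportions `p / (p + q)` for which the mean of `p` copies of `b` and
`q` copies of `a` is at most `x`. -/
noncomputable def generator (a b : ℝ) (m : Multiset ℝ → ℝ) (x : ℝ) : ℝ :=
  sSup {r | ∃ p q : ℕ, 0 < p + q ∧ m (endpoints a b p q) ≤ x ∧ r = p / ((p : ℝ) + q)}

theorem bddAbove_proportions (m : Multiset ℝ → ℝ) (x : ℝ) :
    BddAbove {r : ℝ | ∃ p q : ℕ, 0 < p + q ∧ m (endpoints a b p q) ≤ x ∧
      r = p / ((p : ℝ) + q)} := by
  refine ⟨1, ?_⟩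
  rintro r ⟨p, q, -, -, rfl⟩
  exact div_le_one_of_le₀ (by simp) (by positivity)

theorem generator_mean_endpoints (h : IsAssociativeMean a b m) (hab : a < b) {p q : ℕ}
    (hpq : 0 < p + q) : generator a b m (m (endpoints a b p q)) = p / ((p : ℝ) + q) := by
  refine IsGreatest.csSup_eq ⟨⟨p, q, hpq, le_rfl, rfl⟩, ?_⟩
  rintro r ⟨p', q', hpq', hle, rfl⟩
  by_contra! hlt
  rw [div_lt_div_iff₀ (by exact_mod_cast hpq) (by exact_mod_cast hpq')] at hlt
  exact hle.not_gt (h.mean_endpoints_lt_of_lt hab (by exact_mod_cast hlt))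

theorem mean_endpoints_zero (h : IsAssociativeMean a b m) (hab : a ≤ b) :
    m (endpoints a b 0 1) = a := by
  simpa [endpoints] using h.replicate 1 one_ne_zero a (left_mem_Icc.2 hab)

theorem mean_endpoints_one (h : IsAssociativeMean a b m) (hab : a ≤ b) :
    m (endpoints a b 1 0) = b := by
  simpa [endpoints] using h.replicate 1 one_ne_zero b (right_mem_Icc.2 hab)

theorem monotoneOn_generator (h : IsAssociativeMean a b m) (hab : a ≤ b) :
    MonotoneOn (generator a b m) (Icc a b) := by
  intro x hx y _ hxy
  refine csSup_le_csSup (bddAbove_proportions m y)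
    ⟨0, 0, 1, by simp, (h.mean_endpoints_zero hab).trans_le hx.1, by simp⟩ ?_
  rintro r ⟨p, q, hpq, hle, rfl⟩
  exact ⟨p, q, hpq, hle.trans hxy, rfl⟩

theorem generator_mem (h : IsAssociativeMean a b m) (hab : a < b) {x : ℝ} (hx : x ∈ Icc a b) :
    generator a b m x ∈ Icc (0 : ℝ) 1 := by
  have h0 := h.generator_mean_endpoints hab (p := 0) (q := 1) (by simp)
  have h1 := h.generator_mean_endpoints hab (p := 1) (q := 0) (by simp)
  rw [h.mean_endpoints_zero hab.le] at h0
  rw [h.mean_endpoints_one hab.le] at h1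
  have h2 := h.monotoneOn_generator hab.le (left_mem_Icc.2 hab.le) hx hx.1
  have h3 := h.monotoneOn_generator hab.le hx (right_mem_Icc.2 hab.le) hx.2
  rw [h0] at h2
  rw [h1] at h3
  exact ⟨by simpa using h2, by simpa using h3⟩

/-- The means of multisets of endpoints. -/
def endpointMeans (a b : ℝ) (m : Multiset ℝ → ℝ) : Set ℝ :=
  {x | ∃ p q : ℕ, 0 < p + q ∧ m (endpoints a b p q) = x}

theorem endpointMeans_subset (h : IsAssociativeMean a b m) (hab : a ≤ b) :
    endpointMeans a b m ⊆ Icc a b := by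
  rintro x ⟨p, q, hpq, rfl⟩
  exact h.mem_Icc hab (endpoints_ne_zero hpq) (endpoints_mem hab p q)

theorem exists_interchangeable_endpoints (h : IsAssociativeMean a b m) (hab : a < b)
    {s : Multiset ℝ} (hs : ∀ x ∈ s, x ∈ endpointMeans a b m) :
    ∃ n p q : ℕ, 0 < n ∧ Interchangeable a b m (n • s) (endpoints a b p q) ∧
      n * (s.map (generator a b m)).sum = p := by
  induction s using Multiset.induction with
  | empty => exact ⟨1, 0, 0, one_pos, by simpa [endpoints] using .refl (by simp), by simp⟩
  | cons x s ih =>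
    obtain ⟨n, p, q, hn, hI, hsum⟩ := ih fun y hy => hs y (Multiset.mem_cons_of_mem hy)
    obtain ⟨k, l, hkl, rfl⟩ := hs x (Multiset.mem_cons_self x s)
    have hx := (h.interchangeable_replicate hab.le (endpoints_ne_zero hkl)
      (endpoints_mem hab.le k l)).symm
    refine ⟨n * (k + l), n * k + (k + l) * p, n * l + (k + l) * q, by positivity, ?_, ?_⟩
    · have := (hx.nsmul n).add (hI.nsmul (k + l))
      rw [card_endpoints, nsmul_endpoints, nsmul_endpoints, endpoints_add] at this
      convert this using 1
      rw [← Multiset.singleton_add, nsmul_add, Multiset.nsmul_singleton,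
        Multiset.nsmul_replicate, mul_comm n, mul_smul, mul_comm]
    · rw [Multiset.map_cons, Multiset.sum_cons, h.generator_mean_endpoints hab hkl]
      have hkl' : (k : ℝ) + l ≠ 0 := by exact_mod_cast hkl.ne'
      push_cast
      rw [← hsum]
      field_simp

theorem exists_mean_eq_endpoints (h : IsAssociativeMean a b m) (hab : a < b)
    {s : Multiset ℝ} (hs0 : s ≠ 0) (hs : ∀ x ∈ s, x ∈ endpointMeans a b m) :
    m s ∈ endpointMeans a b m ∧
      s.card * generator a b m (m s) = (s.map (generator a b m)).sum := by
  obtain ⟨n, p, q, hn, hI, hsum⟩ := h.exists_interchangeable_endpoints hab hs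
  have hc : 0 < s.card := Multiset.card_pos.2 hs0
  have hcard : n * s.card = p + q := by
    simpa [card_endpoints] using hI.card_eq
  have hpq : 0 < p + q := hcard ▸ Nat.mul_pos hn hc
  have hm : m s = m (endpoints a b p q) := by
    rw [← hI.mean_eq, h.mean_nsmul hab.le hs0
      (fun x hx => h.endpointMeans_subset hab.le (hs x hx)) hn.ne']
  refine ⟨⟨p, q, hpq, hm.symm⟩, ?_⟩
  have hcard' : (n : ℝ) * s.card = p + q := by exact_mod_cast hcard
  have hn' : (n : ℝ) ≠ 0 := by positivity
  have hc' : (s.card : ℝ) ≠ 0 := by positivity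
  rw [hm, h.generator_mean_endpoints hab hpq, ← hcard', ← hsum]
  field_simp

theorem pair_mem_closure (h : IsAssociativeMean a b m) (hab : a < b) {x y : ℝ}
    (hx : x ∈ closure (endpointMeans a b m)) (hy : y ∈ closure (endpointMeans a b m)) :
    m {x, y} ∈ closure (endpointMeans a b m) := by
  have hsub : closure (endpointMeans a b m) ⊆ Icc a b :=
    closure_minimal (h.endpointMeans_subset hab.le) isClosed_Icc
  have key {z : ℝ} (hz : z ∈ Icc a b)
      (H : ∀ t ∈ endpointMeans a b m, m {t, z} ∈ closure (endpointMeans a b m)) :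
      ∀ t ∈ closure (endpointMeans a b m), m {t, z} ∈ closure (endpointMeans a b m) := by
    intro t ht
    have hcont := (h.continuousOn_cons {z} (by simpa using hz)).mono hsub
    have := hcont.image_closure (mem_image_of_mem _ ht)
    refine closure_minimal ?_ isClosed_closure this
    rintro _ ⟨t, ht, rfl⟩
    exact H t ht
  refine key (hsub hy) (fun t ht => ?_) x hx
  rw [Multiset.pair_comm]
  refine key (h.endpointMeans_subset hab.le ht) (fun u hu => subset_closure ?_) y hy
  refine (h.exists_mean_eq_endpoints hab (by simp) ?_).1
  simp [hu, ht]

theorem closure_endpointMeans (h : IsAssociativeMean a b m) (hab : a < b) :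
    closure (endpointMeans a b m) = Icc a b := by
  set K := closure (endpointMeans a b m) with hK
  have hsub : K ⊆ Icc a b :=
    closure_minimal (h.endpointMeans_subset hab.le) isClosed_Icc
  have hKc : IsClosed K := isClosed_closure
  have ha : a ∈ K := subset_closure ⟨0, 1, by simp, h.mean_endpoints_zero hab.le⟩
  have hb : b ∈ K := subset_closure ⟨1, 0, by simp, h.mean_endpoints_one hab.le⟩
  refine hsub.antisymm fun x hx => ?_
  by_contra hxK
  obtain ⟨c, ⟨hcK, hcx⟩, hc⟩ := ((isCompact_Icc (a := a) (b := x)).inter_left hKc).exists_isGreatest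
    ⟨a, ha, le_rfl, hx.1⟩
  obtain ⟨d, ⟨hdK, hdx⟩, hd⟩ := ((isCompact_Icc (a := x) (b := b)).inter_left hKc).exists_isLeast
    ⟨b, hb, hx.2, le_rfl⟩
  have hcx' : c < x := hcx.2.lt_of_ne fun e => hxK (e ▸ hcK)
  have hdx' : x < d := hdx.1.lt_of_ne fun e => hxK (e ▸ hdK)
  have hcd := hcx'.trans hdx'
  have hcI := hsub hcK
  have hdI := hsub hdK
  have hmK := h.pair_mem_closure hab hcK hdK
  have h1 : c < m {c, d} := by
    have := h.strictMonoOn_cons {c} (by simpa using hcI) hcI hdI hcd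
    have e := h.replicate 2 two_ne_zero c hcI
    rw [Multiset.pair_comm]
    simp only [Multiset.replicate_succ, Multiset.replicate_zero] at e
    exact e.symm.trans_lt this
  have h2 : m {c, d} < d := by
    have := h.strictMonoOn_cons {d} (by simpa using hdI) hcI hdI hcd
    have e := h.replicate 2 two_ne_zero d hdI
    simp only [Multiset.replicate_succ, Multiset.replicate_zero] at e
    exact this.trans_eq e
  rcases le_total (m {c, d}) x with hle | hle
  · exact h1.not_ge (hc ⟨hmK, (hsub hmK).1, hle⟩)
  · exact h2.not_ge (hd ⟨hmK, hle, (hsub hmK).2⟩)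

theorem exists_endpointMeans_between (h : IsAssociativeMean a b m) (hab : a < b) {x y : ℝ}
    (hx : x ∈ Icc a b) (hy : y ∈ Icc a b) (hxy : x < y) :
    ∃ z ∈ endpointMeans a b m, z ∈ Ioo x y := by
  have hmid : (x + y) / 2 ∈ closure (endpointMeans a b m) := by
    rw [h.closure_endpointMeans hab]
    constructor <;> linarith [hx.1, hy.2]
  obtain ⟨z, hz, hz'⟩ := mem_closure_iff.1 hmid (Ioo x y) isOpen_Ioo
    ⟨by linarith, by linarith⟩
  exact ⟨z, hz', hz⟩

theorem strictMonoOn_generator (h : IsAssociativeMean a b m) (hab : a < b) :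
    StrictMonoOn (generator a b m) (Icc a b) := by
  intro x hx y hy hxy
  obtain ⟨z, hzD, hz⟩ := h.exists_endpointMeans_between hab hx hy hxy
  have hzI := h.endpointMeans_subset hab.le hzD
  obtain ⟨w, hwD, hw⟩ := h.exists_endpointMeans_between hab hzI hy hz.2
  have hwI := h.endpointMeans_subset hab.le hwD
  have mono := h.monotoneOn_generator hab.le
  refine (mono hx hzI hz.1.le).trans_lt (lt_of_lt_of_le ?_ (mono hwI hy hw.2.le))
  refine (mono hzI hwI hw.1.le).lt_of_ne fun e => ?_
  obtain ⟨p, q, hpq, rfl⟩ := hzD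
  obtain ⟨p', q', hpq', rfl⟩ := hwD
  rw [h.generator_mean_endpoints hab hpq, h.generator_mean_endpoints hab hpq',
    div_eq_div_iff (by exact_mod_cast hpq.ne') (by exact_mod_cast hpq'.ne')] at e
  have e' : p * (p' + q') = p' * (p + q) := by exact_mod_cast e
  refine hw.1.ne ?_
  have e'' : (p' + q') * q = (p + q) * q' := by nlinarith
  rw [← h.mean_nsmul hab.le (endpoints_ne_zero hpq) (endpoints_mem hab.le p q) hpq'.ne',
    ← h.mean_nsmul hab.le (endpoints_ne_zero hpq') (endpoints_mem hab.le p' q') hpq.ne',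
    nsmul_endpoints, nsmul_endpoints, e'', mul_comm (p' + q'), e', mul_comm p']

theorem continuousOn_generator (h : IsAssociativeMean a b m) (hab : a < b) :
    ContinuousOn (generator a b m) (Icc a b) := by
  rw [continuousOn_iff_continuous_domRestrict]
  let F : Icc a b → Icc (0 : ℝ) 1 := fun x => ⟨generator a b m x, h.generator_mem hab x.2⟩
  have hmono : Monotone F := fun x y hxy => h.monotoneOn_generator hab.le x.2 y.2 hxy
  have hdense : DenseRange F := by
    refine dense_of_exists_between fun {x y} hxy => ?_
    obtain ⟨r, hxr, hry⟩ := exists_rat_btwn (Subtype.coe_lt_coe.2 hxy)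
    have hr0 : (0 : ℚ) ≤ r := by exact_mod_cast x.2.1.trans hxr.le
    have hr1 : r ≤ 1 := by exact_mod_cast hry.le.trans y.2.2
    have hnum : (r.num.toNat : ℤ) = r.num := Int.toNat_of_nonneg (Rat.num_nonneg.2 hr0)
    have hle : r.num.toNat ≤ r.den := by
      have := Rat.num_le_denom_iff.2 hr1
      omega
    have hpos : 0 < r.num.toNat + (r.den - r.num.toNat) := by
      have := r.den_pos
      omega
    have hval := h.generator_mean_endpoints hab hpos
    have hr : (r.num.toNat : ℝ) / (r.num.toNat + (r.den - r.num.toNat : ℕ)) = r := by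
      rw [← Nat.cast_add, Nat.add_sub_cancel' hle, ← Int.cast_natCast, hnum]
      exact (Rat.cast_def r).symm
    rw [hr] at hval
    refine ⟨_, ⟨⟨_, h.mem_Icc hab.le (endpoints_ne_zero hpos) (endpoints_mem hab.le _ _)⟩, rfl⟩,
      ?_, ?_⟩
    · rw [← Subtype.coe_lt_coe]
      exact hxr.trans_eq hval.symm
    · rw [← Subtype.coe_lt_coe]
      exact hval.trans_lt hry
  exact continuous_subtype_val.comp (hmono.continuous_of_denseRange hdense)

theorem card_mul_generator_mean_add (h : IsAssociativeMean a b m) (hab : a < b)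
    (s t : Multiset ℝ) (hst : s + t ≠ 0) (hs : ∀ x ∈ s, x ∈ Icc a b)
    (ht : ∀ x ∈ t, x ∈ endpointMeans a b m) :
    (s + t).card * generator a b m (m (s + t)) = ((s + t).map (generator a b m)).sum := by
  induction s using Multiset.induction generalizing t with
  | empty =>
    simp only [zero_add] at hst ⊢
    exact (h.exists_mean_eq_endpoints hab hst ht).2
  | cons x s ih =>
    have hs' : ∀ y ∈ s, y ∈ Icc a b := fun y hy => hs y (Multiset.mem_cons_of_mem hy)
    have hmem := Interchangeable.mem_add hs' fun y hy => h.endpointMeans_subset hab.le (ht y hy)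
    have hD : EqOn (fun y => ((s + t).card + 1 : ℝ) * generator a b m (m (y ::ₘ (s + t))))
        (fun y => generator a b m y + ((s + t).map (generator a b m)).sum)
        (endpointMeans a b m) := by
      intro y hy
      have := ih (y ::ₘ t) (by simp) hs' (by
        intro z hz
        rcases Multiset.mem_cons.1 hz with rfl | hz
        exacts [hy, ht z hz])
      simpa only [Multiset.add_cons, Multiset.card_cons, Multiset.map_cons, Multiset.sum_cons,
        Nat.cast_add, Nat.cast_one] using this
    have hcont := h.continuousOn_generator hab
    have hmaps : MapsTo (fun y => m (y ::ₘ (s + t))) (Icc a b) (Icc a b) := fun y hy =>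
      h.mem_Icc hab.le (by simp) (by
        intro z hz
        rcases Multiset.mem_cons.1 hz with rfl | hz
        exacts [hy, hmem z hz])
    have := hD.of_subset_closure
      (continuousOn_const.mul (hcont.comp (h.continuousOn_cons _ hmem) hmaps))
      (hcont.add continuousOn_const) (h.endpointMeans_subset hab.le)
      (h.closure_endpointMeans hab).ge (hs x (Multiset.mem_cons_self x s))
    simpa only [Multiset.cons_add, Multiset.card_cons, Multiset.map_cons, Multiset.sum_cons,
      Nat.cast_add, Nat.cast_one] using this

end IsAssociativeMean

section OfFn

variable {a b : ℝ} {M : ∀ n : ℕ, (Fin n → ℝ) → ℝ}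

/-- The function of finite multisets obtained by applying a sequence of functions of tuples to
an arbitrary enumeration. -/
noncomputable def multisetMean (M : ∀ n : ℕ, (Fin n → ℝ) → ℝ) (s : Multiset ℝ) : ℝ :=
  M s.toList.length s.toList.get

theorem Fin.exists_perm_comp_eq_of_ofFn_perm {n : ℕ} {x y : Fin n → ℝ}
    (h : List.Perm (List.ofFn x) (List.ofFn y)) :
    ∃ σ τ : Equiv.Perm (Fin n), x ∘ σ = y ∘ τ := by
  refine ⟨Tuple.sort x, Tuple.sort y, List.ofFn_injective ?_⟩
  have hp := (((Tuple.sort x).ofFn_comp_perm x).trans h).trans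
    ((Tuple.sort y).ofFn_comp_perm y).symm
  exact hp.eq_of_pairwise' (Tuple.monotone_sort x).sortedLE_ofFn.pairwise
    (Tuple.monotone_sort y).sortedLE_ofFn.pairwise

theorem multisetMean_ofFn
    (hsymm : ∀ n : ℕ, 0 < n → ∀ x : Fin n → ℝ, (∀ j, x j ∈ Icc a b) →
      ∀ π : Equiv.Perm (Fin n), M n (x ∘ π) = M n x)
    {n : ℕ} (hn : 0 < n) {x : Fin n → ℝ} (hx : ∀ j, x j ∈ Icc a b) :
    multisetMean M (List.ofFn x : Multiset ℝ) = M n x := by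
  have key (l : List ℝ) (hl : List.Perm l (List.ofFn x)) : M l.length l.get = M n x := by
    obtain rfl : l.length = n := by simpa using hl.length_eq
    replace hl : List.Perm (List.ofFn l.get) (List.ofFn x) := by rwa [List.ofFn_get]
    obtain ⟨σ, τ, h⟩ := Fin.exists_perm_comp_eq_of_ofFn_perm hl
    have hmem : ∀ j, l.get j ∈ Icc a b := fun j => by
      have : l.get j ∈ List.ofFn x := hl.subset (by simp)
      obtain ⟨i, hi⟩ := (List.mem_ofFn' _ _).1 this
      exact hi ▸ hx i
    rw [← hsymm _ hn _ hmem σ, h, hsymm _ hn x hx τ]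
  exact key _ (Multiset.coe_eq_coe.1 (Multiset.coe_toList _))

theorem Multiset.exists_ofFn_eq (s : Multiset ℝ) :
    ∃ x : Fin s.card → ℝ, (List.ofFn x : Multiset ℝ) = s := by
  induction s using Quotient.inductionOn with
  | h l => exact ⟨l.get, congrArg _ (List.ofFn_get l)⟩

theorem forall_mem_of_ofFn_eq {s : Multiset ℝ} {n : ℕ} {x : Fin n → ℝ}
    (hs : ∀ t ∈ s, t ∈ Icc a b) (hx : (List.ofFn x : Multiset ℝ) = s) : ∀ i, x i ∈ Icc a b :=
  fun i => hs _ (hx ▸ by simp)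

theorem isAssociativeMean_multisetMean
    (hcm : ∀ n : ℕ, 0 < n → ∀ (x : Fin n → ℝ), (∀ j, x j ∈ Icc a b) → ∀ i : Fin n,
      ContinuousOn (fun t => M n (Function.update x i t)) (Icc a b) ∧
      StrictMonoOn (fun t => M n (Function.update x i t)) (Icc a b))
    (hsymm : ∀ n : ℕ, 0 < n → ∀ x : Fin n → ℝ, (∀ j, x j ∈ Icc a b) →
      ∀ π : Equiv.Perm (Fin n), M n (x ∘ π) = M n x)
    (hrefl : ∀ n : ℕ, 0 < n → ∀ t ∈ Icc a b, M n (fun _ => t) = t)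
    (hassoc : ∀ n m : ℕ, 0 < n → 0 < m → ∀ (x : Fin n → ℝ) (y : Fin m → ℝ),
      (∀ i, x i ∈ Icc a b) → (∀ j, y j ∈ Icc a b) →
      M (n + m) (Fin.append x y) = M (n + m) (Fin.append (fun _ : Fin n => M n x) y)) :
    IsAssociativeMean a b (multisetMean M) := by
  have hcons (s : Multiset ℝ) (hs : ∀ x ∈ s, x ∈ Icc a b) :
      ContinuousOn (fun t => multisetMean M (t ::ₘ s)) (Icc a b) ∧
        StrictMonoOn (fun t => multisetMean M (t ::ₘ s)) (Icc a b) := by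
    obtain ⟨x, hx⟩ := s.exists_ofFn_eq
    have hxI := forall_mem_of_ofFn_eq hs hx
    have heq : EqOn (fun t => multisetMean M (t ::ₘ s))
        (fun t => M (s.card + 1) (Fin.cons t x)) (Icc a b) := by
      intro t ht
      have := multisetMean_ofFn hsymm (Nat.succ_pos _) (x := Fin.cons t x)
        (Fin.forall_fin_succ.2 ⟨by simpa using ht, by simpa using hxI⟩)
      rw [List.ofFn_cons, ← Multiset.cons_coe, hx] at this
      exact this
    rcases (Icc a b).eq_empty_or_nonempty with he | ⟨c, hc⟩
    · simp [he, StrictMonoOn]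
    · have := hcm _ (Nat.succ_pos _) (Fin.cons c x)
        (Fin.forall_fin_succ.2 ⟨by simpa using hc, by simpa using hxI⟩) 0
      simp only [Fin.update_cons_zero] at this
      exact ⟨this.1.congr heq, this.2.congr heq.symm⟩
  have hstrict : IsStrictMean a b (multisetMean M) := by
    refine ⟨fun s hs => (hcons s hs).1, fun s hs => (hcons s hs).2, fun n hn t ht => ?_⟩
    have := multisetMean_ofFn hsymm (Nat.pos_of_ne_zero hn) (x := fun _ => t) fun _ => ht
    rwa [List.ofFn_const, Multiset.coe_replicate, hrefl n (Nat.pos_of_ne_zero hn) t ht] at this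
  refine ⟨hstrict, fun s t hs0 hs ht => ?_⟩
  obtain ⟨x, hx⟩ := s.exists_ofFn_eq
  obtain ⟨y, hy⟩ := t.exists_ofFn_eq
  have hxI := forall_mem_of_ofFn_eq hs hx
  have hyI := forall_mem_of_ofFn_eq ht hy
  have hsc : 0 < s.card := Multiset.card_pos.2 hs0
  have hab : a ≤ b := (hxI ⟨0, hsc⟩).1.trans (hxI ⟨0, hsc⟩).2
  have hsI := hstrict.mem_Icc hab hs0 hs
  have hms : multisetMean M s = M s.card x := by
    rw [← multisetMean_ofFn hsymm hsc hxI, hx]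
  rcases Nat.eq_zero_or_pos t.card with htc | htc
  · rw [Multiset.card_eq_zero.1 htc, add_zero, add_zero, hstrict.replicate _ hsc.ne' _ hsI]
  have happ (z : Fin s.card → ℝ) (hz : ∀ i, z i ∈ Icc a b) :
      multisetMean M (List.ofFn z + t) = M (s.card + t.card) (Fin.append z y) := by
    rw [← multisetMean_ofFn hsymm (Nat.add_pos_left hsc _), List.ofFn_fin_append,
      ← Multiset.coe_add, hy]
    exact fun j => Fin.addCases (by simpa using hz) (by simpa using hyI) j
  have h1 := happ x hxI
  have h2 := happ (fun _ => M s.card x) fun _ => hms ▸ hsI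
  rw [hx] at h1
  rw [List.ofFn_const, Multiset.coe_replicate] at h2
  rw [h1, hms, h2, hassoc _ _ hsc htc x y hxI hyI]

end OfFn

section QuasiArithmetic

variable {a b : ℝ}

theorem StrictMonoOn.continuousOn_of_continuousOn_comp {f g : ℝ → ℝ}
    (hf : StrictMonoOn f (Icc a b)) (hfc : ContinuousOn f (Icc a b)) {s : Set ℝ}
    (hg : MapsTo g s (Icc a b)) (hfg : ContinuousOn (fun t => f (g t)) s) :
    ContinuousOn g s := by
  have hemb := hfc.domRestrict.isClosedEmbedding (injOn_iff_injective.1 hf.injOn)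
  have : Continuous (hg.restrict g s (Icc a b)) :=
    hemb.isInducing.continuous_iff.2 hfg.domRestrict
  rw [continuousOn_iff_continuous_domRestrict]
  exact continuous_subtype_val.comp this

/-- `M` is the sequence of quasi-arithmetic means on `[a, b]` generated by `f`. -/
def IsQuasiArithmetic (a b : ℝ) (f : ℝ → ℝ) (M : ∀ n : ℕ, (Fin n → ℝ) → ℝ) : Prop :=
  ∀ n : ℕ, 0 < n → ∀ x : Fin n → ℝ, (∀ i, x i ∈ Icc a b) →
    M n x ∈ Icc a b ∧ f (M n x) = (∑ i, f (x i)) / n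

namespace IsQuasiArithmetic

variable {f : ℝ → ℝ} {M : ∀ n : ℕ, (Fin n → ℝ) → ℝ}

theorem neg (h : IsQuasiArithmetic a b f M) : IsQuasiArithmetic a b (fun t => -f t) M := by
  intro n hn x hx
  obtain ⟨h1, h2⟩ := h n hn x hx
  exact ⟨h1, by simp only [h2, Finset.sum_neg_distrib, neg_div]⟩

theorem continuousOn_and_strictMonoOn_update (h : IsQuasiArithmetic a b f M)
    (hfc : ContinuousOn f (Icc a b)) (hf : StrictMonoOn f (Icc a b)) {n : ℕ} (hn : 0 < n)
    {x : Fin n → ℝ} (hx : ∀ j, x j ∈ Icc a b) (i : Fin n) :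
    ContinuousOn (fun t => M n (Function.update x i t)) (Icc a b) ∧
      StrictMonoOn (fun t => M n (Function.update x i t)) (Icc a b) := by
  have hmem : ∀ t ∈ Icc a b, ∀ j, Function.update x i t j ∈ Icc a b := fun t ht j => by
    rcases eq_or_ne j i with rfl | hj
    · simpa using ht
    · simpa [hj] using hx j
  have hval : ∀ t ∈ Icc a b, f (M n (Function.update x i t)) =
      (f t + ∑ j ∈ Finset.univ.erase i, f (x j)) / n := fun t ht => by
    rw [(h n hn _ (hmem t ht)).2, ← Finset.add_sum_erase _ _ (Finset.mem_univ i),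
      Function.update_self]
    congr 2
    exact Finset.sum_congr rfl fun j hj => by
      rw [Function.update_of_ne (Finset.ne_of_mem_erase hj)]
  have hmaps : MapsTo (fun t => M n (Function.update x i t)) (Icc a b) (Icc a b) :=
    fun t ht => (h n hn _ (hmem t ht)).1
  refine ⟨hf.continuousOn_of_continuousOn_comp hfc hmaps ?_, fun t ht u hu htu => ?_⟩
  · exact ((hfc.add continuousOn_const).div_const _).congr hval
  · refine (hf.lt_iff_lt (hmaps ht) (hmaps hu)).1 ?_
    rw [hval t ht, hval u hu]
    have := hf ht hu htu
    gcongr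

theorem comp_perm (h : IsQuasiArithmetic a b f M) (hf : InjOn f (Icc a b)) {n : ℕ} (hn : 0 < n)
    {x : Fin n → ℝ} (hx : ∀ j, x j ∈ Icc a b) (π : Equiv.Perm (Fin n)) :
    M n (x ∘ π) = M n x := by
  have h1 := h n hn (x ∘ π) fun j => hx (π j)
  have h2 := h n hn x hx
  refine hf h1.1 h2.1 ?_
  rw [h1.2, h2.2, ← Equiv.sum_comp π fun i => f (x i)]
  rfl

theorem apply_const (h : IsQuasiArithmetic a b f M) (hf : InjOn f (Icc a b)) {n : ℕ}
    (hn : 0 < n) {t : ℝ} (ht : t ∈ Icc a b) : M n (fun _ => t) = t := by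
  have h1 := h n hn (fun _ => t) fun _ => ht
  refine hf h1.1 ht ?_
  have hn' : (n : ℝ) ≠ 0 := by positivity
  rw [h1.2]
  simp [hn']

theorem append (h : IsQuasiArithmetic a b f M) (hf : InjOn f (Icc a b)) {n m : ℕ} (hn : 0 < n)
    {x : Fin n → ℝ} {y : Fin m → ℝ} (hx : ∀ i, x i ∈ Icc a b) (hy : ∀ j, y j ∈ Icc a b) :
    M (n + m) (Fin.append x y) = M (n + m) (Fin.append (fun _ : Fin n => M n x) y) := by
  have hM := h n hn x hx
  have key (z : Fin n → ℝ) (hz : ∀ i, z i ∈ Icc a b) :=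
    h (n + m) (Nat.add_pos_left hn m) (Fin.append z y) fun j =>
      Fin.addCases (by simpa using hz) (by simpa using hy) j
  have h1 := key x hx
  have h2 := key (fun _ => M n x) fun _ => hM.1
  refine hf h1.1 h2.1 ?_
  have hn' : (n : ℝ) ≠ 0 := by positivity
  rw [h1.2, h2.2]
  simp only [Fin.sum_univ_add, Fin.append_left, Fin.append_right, hM.2, Finset.sum_const,
    Finset.card_univ, Fintype.card_fin, nsmul_eq_mul, mul_div_cancel₀ _ hn']

end IsQuasiArithmetic

end QuasiArithmetic

/-- Characterisation of quasi-arithmetic means (Kolmogorov (1930),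
Nagumo (1930), de Finetti (1931)). The compact nondegenerate interval is
`I = [a, b]` with `a < b`; the equation `f (M n x) = (∑ f (xᵢ)) / n` together
with `M n x ∈ I` expresses `M n x = f⁻¹ ((1/n) ∑ f (xᵢ))` since `f` is
injective on `I`. -/
theorem charac_quasi_arithmetic_means (a b : ℝ) (hab : a < b)
    (M : ∀ n : ℕ, (Fin n → ℝ) → ℝ) :
    (∃ f : ℝ → ℝ, ContinuousOn f (Set.Icc a b) ∧
        (StrictMonoOn f (Set.Icc a b) ∨ StrictAntiOn f (Set.Icc a b)) ∧
        ∀ n : ℕ, 0 < n → ∀ x : Fin n → ℝ, (∀ i, x i ∈ Set.Icc a b) →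
          M n x ∈ Set.Icc a b ∧ f (M n x) = (∑ i, f (x i)) / n) ↔
      ((∀ n : ℕ, 0 < n → ∀ (x : Fin n → ℝ), (∀ j, x j ∈ Set.Icc a b) →
          ∀ i : Fin n,
            ContinuousOn (fun t => M n (Function.update x i t)) (Set.Icc a b) ∧
            StrictMonoOn (fun t => M n (Function.update x i t)) (Set.Icc a b)) ∧
       (∀ n : ℕ, 0 < n → ∀ (x : Fin n → ℝ), (∀ j, x j ∈ Set.Icc a b) →
          ∀ π : Equiv.Perm (Fin n), M n (x ∘ π) = M n x) ∧
       (∀ n : ℕ, 0 < n → ∀ t ∈ Set.Icc a b, M n (fun _ => t) = t) ∧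
       (∀ n m : ℕ, 0 < n → 0 < m → ∀ (x : Fin n → ℝ) (y : Fin m → ℝ),
          (∀ i, x i ∈ Set.Icc a b) → (∀ j, y j ∈ Set.Icc a b) →
          M (n + m) (Fin.append x y)
            = M (n + m) (Fin.append (fun _ : Fin n => M n x) y))) := by
  constructor
  · rintro ⟨f, hfc, hf, hM⟩
    obtain ⟨g, hgc, hg, hgM⟩ : ∃ g : ℝ → ℝ, ContinuousOn g (Icc a b) ∧
        StrictMonoOn g (Icc a b) ∧ IsQuasiArithmetic a b g M := by
      rcases hf with hf | hf
      · exact ⟨f, hfc, hf, hM⟩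
      · exact ⟨fun t => -f t, hfc.neg, hf.neg, IsQuasiArithmetic.neg hM⟩
    exact ⟨fun n hn x hx i => hgM.continuousOn_and_strictMonoOn_update hgc hg hn hx i,
      fun n hn x hx π => hgM.comp_perm hg.injOn hn hx π,
      fun n hn t ht => hgM.apply_const hg.injOn hn ht,
      fun n m hn _ x y hx hy => hgM.append hg.injOn hn hx hy⟩
  · rintro ⟨hcm, hsymm, hrefl, hassoc⟩
    have h := isAssociativeMean_multisetMean hcm hsymm hrefl hassoc
    refine ⟨IsAssociativeMean.generator a b (multisetMean M), h.continuousOn_generator hab,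
      .inl (h.strictMonoOn_generator hab), fun n hn x hx => ?_⟩
    have hmem : ∀ t ∈ (List.ofFn x : Multiset ℝ), t ∈ Icc a b := by
      simpa [List.mem_ofFn'] using hx
    have hne : (List.ofFn x : Multiset ℝ) ≠ 0 := by
      rw [← Multiset.card_pos]
      simpa using hn
    have hsum := h.card_mul_generator_mean_add hab (List.ofFn x) 0 (by simpa using hne) hmem
      (by simp)
    have hI := h.mem_Icc hab.le hne hmem
    rw [add_zero, multisetMean_ofFn hsymm hn hx] at hsum
    rw [multisetMean_ofFn hsymm hn hx] at hI
    refine ⟨hI, ?_⟩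
    rw [eq_div_iff (by positivity), mul_comm]
    simpa [List.sum_ofFn, List.map_ofFn] using hsum
end
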